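/- arXiv:1501.01198 — 5 statements merged into one kernel-verified Lean document; each statement's English description precedes it below -/
import Mathlib

section
/- For any ρ-patch P of V, the natural density of the set of translations t for which the ρ-patch of V at t contains P exists and is given by an infinite product: dens({t ∈ ℤ² : P ⊆ (V − t) ∩ B_ρ(0)}) = ∏_p (1 − |P_p| / p²), the product running over all primes p. -/
open Filter Topology

/-- The set of visible points of the square lattice `ℤ²`. -/
def Vis : Set (ℤ × ℤ) := {x | Int.gcd x.1 x.2 = 1}

/-- Reduction of a finite subset of `ℤ²` modulo `m`. -/
def redF (m : ℕ) (P : Finset (ℤ × ℤ)) : Finset (ZMod m × ZMod m) :=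
  P.image fun x => ((x.1 : ZMod m), (x.2 : ZMod m))

namespace PatchDensity

def Bd (R : ℝ) : Set (ℤ × ℤ) := {t | (t.1 : ℝ)^2 + (t.2 : ℝ)^2 < R^2}

def unitDisc2 : Set (Fin 2 → ℝ) := {x | x 0 ^ 2 + x 1 ^ 2 < 1}

lemma unitDisc2_eq : unitDisc2 = (WithLp.toLp 2 : (Fin 2 → ℝ) → EuclideanSpace ℝ (Fin 2)) ⁻¹' Metric.ball 0 1 := by
  ext x
  simp [unitDisc2, EuclideanSpace.norm_eq, Real.sqrt_lt' one_pos]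

lemma unitDisc2_vol : MeasureTheory.volume.real unitDisc2 = Real.pi := by
  rw [unitDisc2_eq, MeasureTheory.measureReal_def,
    (PiLp.volume_preserving_toLp (Fin 2)).measure_preimage measurableSet_ball.nullMeasurableSet,
    EuclideanSpace.volume_ball_fin_two]
  simp [Real.pi_pos.le]

lemma unitDisc2_bdd : Bornology.IsBounded unitDisc2 := by
  refine (Metric.isBounded_closedBall (x := (0 : Fin 2 → ℝ)) (r := 1)).subset ?_
  intro x hx
  have hx' : x 0 ^ 2 + x 1 ^ 2 < 1 := hx
  rw [mem_closedBall_zero_iff, pi_norm_le_iff_of_nonneg zero_le_one]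
  intro i
  rw [Real.norm_eq_abs, ← sq_le_one_iff_abs_le_one]
  fin_cases i
  · show x 0 ^ 2 ≤ 1
    nlinarith [sq_nonneg (x 1)]
  · show x 1 ^ 2 ≤ 1
    nlinarith [sq_nonneg (x 0)]

lemma unitDisc2_convex : Convex ℝ unitDisc2 := by
  rw [unitDisc2_eq]
  exact (convex_ball (0 : EuclideanSpace ℝ (Fin 2)) 1).linear_preimage
    (WithLp.linearEquiv 2 ℝ (Fin 2 → ℝ)).symm.toLinearMap

open scoped Pointwise in
lemma gauss : Tendsto (fun R : ℝ => ((Bd R).ncard : ℝ) / R ^ 2) atTop (𝓝 Real.pi) := by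
  have h := tendsto_card_div_pow_atTop_volume' unitDisc2 unitDisc2_bdd
    (by
      unfold unitDisc2
      exact measurableSet_lt (by fun_prop) (by fun_prop))
    (unitDisc2_convex.addHaar_frontier _)
    (by
      intro x y hx hxy
      rintro _ ⟨z, hz, rfl⟩
      have hz' : z 0 ^ 2 + z 1 ^ 2 < 1 := hz
      have hy : 0 < y := hx.trans_le hxy
      refine ⟨(y⁻¹ * x) • z, ?_, ?_⟩
      · show ((y⁻¹ * x) • z) 0 ^ 2 + ((y⁻¹ * x) • z) 1 ^ 2 < 1
        have h1 : (y⁻¹ * x) ≤ 1 := by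
          rw [inv_mul_le_iff₀ hy]; simpa using hxy
        have h0 : 0 ≤ y⁻¹ * x := by positivity
        have h2 : (y⁻¹ * x) ^ 2 ≤ 1 := pow_le_one₀ h0 h1
        simp only [Pi.smul_apply, smul_eq_mul]
        nlinarith [sq_nonneg (z 0), sq_nonneg (z 1)]
      · simp only [smul_smul]
        congr 1
        field_simp)
  rw [unitDisc2_vol] at h
  refine h.congr' ?_
  filter_upwards [eventually_gt_atTop 0] with R hR
  simp only [Fintype.card_fin]
  congr 2
  have himg : unitDisc2 ∩ ((R⁻¹ • Submodule.span ℤ (Set.range (Pi.basisFun ℝ (Fin 2))) : Submodule ℤ (Fin 2 → ℝ)) : Set (Fin 2 → ℝ))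
      = (fun t : ℤ × ℤ => R⁻¹ • ![(t.1 : ℝ), (t.2 : ℝ)]) '' Bd R := by
    ext x
    simp only [Set.mem_inter_iff, SetLike.mem_coe, Submodule.mem_smul_pointwise_iff_exists, Set.mem_image,
      Module.Basis.mem_span_iff_repr_mem]
    have key : ∀ a b : ℝ, (R⁻¹ * a) ^ 2 + (R⁻¹ * b) ^ 2 < 1 ↔ a ^ 2 + b ^ 2 < R ^ 2 := by
      intro a b
      rw [mul_pow, mul_pow, ← mul_add, inv_pow, inv_mul_lt_iff₀ (by positivity), mul_one]
    constructor
    · rintro ⟨hx, y, hy, rfl⟩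
      obtain ⟨a, ha⟩ := hy 0
      obtain ⟨b, hb⟩ := hy 1
      simp at ha hb
      refine ⟨(a, b), ?_, ?_⟩
      · have := (key _ _).1 hx
        simpa [Bd, ha, hb] using this
      · congr 1
        ext i; fin_cases i <;> simp [ha, hb]
    · rintro ⟨t, ht, rfl⟩
      refine ⟨?_, _, ?_, rfl⟩
      · exact (key _ _).2 ht
      · intro i
        fin_cases i
        · exact ⟨t.1, by simp⟩
        · exact ⟨t.2, by simp⟩
  have h2 := congrArg Set.ncard himg
  rw [Set.ncard_image_of_injective] at h2
  · exact h2
  · intro t u htu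
    have h0 := congrFun htu 0
    have h1 := congrFun htu 1
    simp [hR.ne'] at h0 h1
    exact Prod.ext h0 h1

lemma tri {x y a b R C : ℝ} (hR : 0 ≤ R) (h : x ^ 2 + y ^ 2 < R ^ 2) (hC : |a| + |b| ≤ C) :
    (x + a) ^ 2 + (y + b) ^ 2 < (R + C) ^ 2 := by
  have hx : |x| ≤ R := abs_le_of_sq_le_sq (by nlinarith [sq_nonneg y]) hR
  have hy : |y| ≤ R := abs_le_of_sq_le_sq (by nlinarith [sq_nonneg x]) hR
  have h1 : x * a ≤ R * |a| := by
    calc x * a ≤ |x * a| := le_abs_self _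
      _ = |x| * |a| := abs_mul _ _
      _ ≤ R * |a| := by gcongr
  have h2 : y * b ≤ R * |b| := by
    calc y * b ≤ |y * b| := le_abs_self _
      _ = |y| * |b| := abs_mul _ _
      _ ≤ R * |b| := by gcongr
  have h3 : (|a| + |b|) ^ 2 ≤ C ^ 2 := by gcongr
  have h4 : R * (|a| + |b|) ≤ R * C := by gcongr
  nlinarith [sq_abs a, sq_abs b, abs_nonneg a, abs_nonneg b, mul_nonneg (abs_nonneg a) (abs_nonneg b)]

lemma Bd_finite (R : ℝ) : (Bd R).Finite := by
  refine Set.Finite.subset (Set.Finite.prod (Set.finite_Icc (-⌈|R|⌉) ⌈|R|⌉)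
    (Set.finite_Icc (-⌈|R|⌉) ⌈|R|⌉)) ?_
  intro t ht
  have ht' : (t.1 : ℝ) ^ 2 + (t.2 : ℝ) ^ 2 < R ^ 2 := ht
  have h1 : |(t.1 : ℝ)| ≤ |R| := sq_le_sq.1 (by nlinarith [sq_nonneg (t.2 : ℝ)])
  have h2 : |(t.2 : ℝ)| ≤ |R| := sq_le_sq.1 (by nlinarith [sq_nonneg (t.1 : ℝ)])
  have key : ∀ n : ℤ, |(n : ℝ)| ≤ |R| → n ∈ Set.Icc (-⌈|R|⌉) ⌈|R|⌉ := by
    intro n hn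
    have : |n| ≤ ⌈|R|⌉ := by
      have := hn.trans (Int.le_ceil |R|)
      exact_mod_cast this
    exact abs_le.1 this
  exact ⟨key _ h1, key _ h2⟩

def cls (M : ℕ) (a : ℤ × ℤ) : Set (ℤ × ℤ) := {t | (M : ℤ) ∣ t.1 - a.1 ∧ (M : ℤ) ∣ t.2 - a.2}

lemma gauss_shift (M : ℕ) (hM : 0 < M) (c : ℝ) :
    Tendsto (fun R : ℝ => ((Bd ((R + c) / M)).ncard : ℝ) / R ^ 2) atTop
      (𝓝 (Real.pi * (1 / (M : ℝ) ^ 2))) := by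
  have hM' : (0 : ℝ) < M := by exact_mod_cast hM
  have h1 : Tendsto (fun R : ℝ => (R + c) / M) atTop atTop :=
    (tendsto_atTop_add_const_right _ c tendsto_id).atTop_div_const hM'
  have h2 := gauss.comp h1
  have h3 : Tendsto (fun R : ℝ => ((1 + c / R) / M) ^ 2) atTop (𝓝 (1 / (M : ℝ) ^ 2)) := by
    have : Tendsto (fun R : ℝ => c / R) atTop (𝓝 0) := tendsto_const_nhds.div_atTop tendsto_id
    have := (((tendsto_const_nhds (x := (1 : ℝ))).add this).div_const (M : ℝ)).pow 2
    simpa using this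
  refine (h2.mul h3).congr' ?_
  filter_upwards [eventually_gt_atTop 0, h1.eventually_gt_atTop 0] with R hR hRc
  have h4 : 0 < R + c := by
    have := (lt_div_iff₀ hM').1 hRc
    simpa using this
  simp only [Function.comp]
  field_simp

lemma cls_density (M : ℕ) (hM : 0 < M) (a : ℤ × ℤ) :
    Tendsto (fun R : ℝ => ((cls M a ∩ Bd R).ncard : ℝ) / R ^ 2) atTop
      (𝓝 (Real.pi * (1 / (M : ℝ) ^ 2))) := by
  have hM' : (0 : ℝ) < M := by exact_mod_cast hM
  set C : ℝ := |(a.1 : ℝ)| + |(a.2 : ℝ)| with hC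
  have hC0 : 0 ≤ C := by positivity
  set f : ℤ × ℤ → ℤ × ℤ := fun u => (a.1 + M * u.1, a.2 + M * u.2) with hf
  have hfi : Function.Injective f := by
    intro u v huv
    have hM'' : (M : ℤ) ≠ 0 := by exact_mod_cast hM.ne'
    simp only [hf, Prod.mk.injEq, add_right_inj, mul_eq_mul_left_iff, hM'', or_false] at huv
    exact Prod.ext huv.1 huv.2
  have hscale : ∀ (u : ℤ × ℤ) (r : ℝ), u ∈ Bd (r / M) ↔
      ((M : ℝ) * u.1) ^ 2 + ((M : ℝ) * u.2) ^ 2 < r ^ 2 := by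
    intro u r
    simp only [Bd, Set.mem_ofPred_eq]
    rw [div_pow, lt_div_iff₀ (by positivity)]
    ring_nf
  refine tendsto_of_tendsto_of_tendsto_of_le_of_le' (gauss_shift M hM (-C)) (gauss_shift M hM C) ?_ ?_
  · filter_upwards [eventually_ge_atTop C] with R hR
    refine div_le_div_of_nonneg_right (Nat.cast_le.2 ?_) (sq_nonneg R)
    rw [← Set.ncard_image_of_injective _ hfi]
    refine Set.ncard_le_ncard ?_ ((Bd_finite R).subset Set.inter_subset_right)
    rintro _ ⟨u, hu, rfl⟩
    refine ⟨⟨by simp [hf], by simp [hf]⟩, ?_⟩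
    have := tri (C := C) (a := a.1) (b := a.2) (by linarith) ((hscale u _).1 hu) le_rfl
    simp only [Bd, Set.mem_ofPred_eq, hf]
    push_cast
    convert this using 1 <;> ring
  · filter_upwards [eventually_ge_atTop 0] with R hR
    refine div_le_div_of_nonneg_right (Nat.cast_le.2 ?_) (sq_nonneg R)
    rw [← Set.ncard_image_of_injective (Bd ((R + C) / M)) hfi]
    refine Set.ncard_le_ncard ?_ ((Bd_finite _).image _)
    rintro t ⟨⟨⟨u, hu⟩, ⟨v, hv⟩⟩, ht⟩
    refine ⟨(u, v), ?_, ?_⟩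
    · rw [hscale]
      have := tri (C := C) (a := -a.1) (b := -a.2) hR ht (by simp [hC])
      have e1 : (M : ℝ) * u = t.1 + -a.1 := by
        have : ((M * u : ℤ) : ℝ) = (t.1 - a.1 : ℤ) := by rw [hu]
        push_cast at this; linarith
      have e2 : (M : ℝ) * v = t.2 + -a.2 := by
        have : ((M * v : ℤ) : ℝ) = (t.2 - a.2 : ℤ) := by rw [hv]
        push_cast at this; linarith
      rw [e1, e2]; exact this
    · simp only [hf]
      ext <;> simp <;> linarith

def redP (m : ℕ) (x : ℤ × ℤ) : ZMod m × ZMod m := ((x.1 : ZMod m), (x.2 : ZMod m))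

def Asv (s : Finset Nat.Primes) (P : Finset (ℤ × ℤ)) : Set (ℤ × ℤ) :=
  {t | ∀ p ∈ s, redP p (-t) ∉ redF p P}

lemma crt_int (s : Finset Nat.Primes) (g : (p : s) → ZMod (p : Nat.Primes)) :
    ∃ a : ℤ, ∀ p : s, (a : ZMod (p : Nat.Primes)) = g p := by
  have hc : Pairwise (Function.onFun Nat.Coprime (fun p : s => ((p : Nat.Primes) : ℕ))) := by
    intro p q hpq
    refine (Nat.coprime_primes (p : Nat.Primes).2 (q : Nat.Primes).2).2 ?_
    intro h
    exact hpq (Subtype.ext (Subtype.ext h))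
  obtain ⟨b, hb⟩ := (ZMod.prodEquivPi _ hc).surjective g
  obtain ⟨a, rfl⟩ := ZMod.intCast_surjective b
  refine ⟨a, fun p => ?_⟩
  rw [← hb, map_intCast]
  rfl

lemma primes_prod_dvd_iff (s : Finset Nat.Primes) (z : ℤ) :
    ((∏ p ∈ s, (p : ℕ) : ℕ) : ℤ) ∣ z ↔ ∀ p ∈ s, ((p : ℕ) : ℤ) ∣ z := by
  constructor
  · intro h p hp
    exact (Int.natCast_dvd_natCast.2 (Finset.dvd_prod_of_mem _ hp)).trans h
  · intro h
    push_cast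
    refine Finset.prod_dvd_of_coprime ?_ h
    intro p _ q _ hpq
    refine Nat.Coprime.isCoprime ?_
    exact (Nat.coprime_primes p.2 q.2).2 (fun h => hpq (Subtype.ext h))

instance primeNeZero (p : Nat.Primes) : NeZero (p : ℕ) := ⟨p.2.ne_zero⟩

lemma Asv_density (s : Finset Nat.Primes) (P : Finset (ℤ × ℤ)) :
    Tendsto (fun R : ℝ => ((Asv s P ∩ Bd R).ncard : ℝ) / (Real.pi * R ^ 2)) atTop
      (𝓝 (∏ p ∈ s, (1 - ((redF (p : ℕ) P).card : ℝ) / ((p : ℕ) : ℝ)^2))) := by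
  classical
  set M : ℕ := ∏ p ∈ s, (p : ℕ) with hMdef
  have hM : 0 < M := Finset.prod_pos fun p _ => p.2.pos
  let G : Finset ((p : s) → ZMod (p : Nat.Primes) × ZMod (p : Nat.Primes)) :=
    Fintype.piFinset fun p : s => (redF (p : Nat.Primes) P)ᶜ
  let φ : ℤ × ℤ → (p : s) → ZMod (p : Nat.Primes) × ZMod (p : Nat.Primes) :=
    fun t p => redP (p : Nat.Primes) (-t)
  have hrep : ∀ f, ∃ a : ℤ × ℤ, ∀ t, t ∈ cls M a ↔ φ t = f := by
    intro f
    obtain ⟨a, ha⟩ := crt_int s (fun p => -(f p).1)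
    obtain ⟨b, hb⟩ := crt_int s (fun p => -(f p).2)
    refine ⟨(a, b), fun t => ?_⟩
    simp only [cls, Set.mem_ofPred_eq, hMdef, primes_prod_dvd_iff, funext_iff]
    have key : ∀ p : s, (((((p : Nat.Primes) : ℕ) : ℤ) ∣ t.1 - a ∧ (((p : Nat.Primes) : ℕ) : ℤ) ∣ t.2 - b)
        ↔ φ t p = f p) := by
      intro p
      rw [← ZMod.intCast_zmod_eq_zero_iff_dvd, ← ZMod.intCast_zmod_eq_zero_iff_dvd]
      simp only [Int.cast_sub, ha, hb, φ, redP, Prod.ext_iff, Prod.fst_neg, Prod.snd_neg, Int.cast_neg,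
        sub_neg_eq_add, neg_eq_iff_add_eq_zero]
    constructor
    · rintro ⟨h1, h2⟩ p
      exact (key p).1 ⟨h1 _ p.2, h2 _ p.2⟩
    · intro h
      exact ⟨fun p hp => ((key ⟨p, hp⟩).2 (h _)).1, fun p hp => ((key ⟨p, hp⟩).2 (h _)).2⟩
  choose a ha using hrep
  have hcount : ∀ R, (Asv s P ∩ Bd R).ncard = ∑ f ∈ G, (cls M (a f) ∩ Bd R).ncard := by
    intro R
    have hfin : (Asv s P ∩ Bd R).Finite := (Bd_finite R).subset Set.inter_subset_right
    have hmem : ∀ t, t ∈ Asv s P ↔ φ t ∈ G := by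
      intro t
      simp [Asv, G, φ, Fintype.mem_piFinset]
    rw [Set.ncard_eq_toFinset_card _ hfin, Finset.card_eq_sum_card_fiberwise (f := φ) (t := G)]
    · refine Finset.sum_congr rfl fun f hf => ?_
      rw [← Set.ncard_coe_finset]
      congr 1
      ext t
      simp only [Finset.coe_filter, Set.Finite.mem_toFinset, Set.mem_inter_iff, Set.mem_ofPred_eq, ha, hmem]
      constructor
      · rintro ⟨⟨h1, h2⟩, h3⟩; exact ⟨h3, h2⟩
      · rintro ⟨h1, h2⟩; exact ⟨⟨h1 ▸ hf, h2⟩, h1⟩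
    · intro t ht
      rw [Finset.mem_coe, Set.Finite.mem_toFinset] at ht
      exact (hmem t).1 ht.1
  have hG : (G.card : ℝ) * (1 / (M : ℝ) ^ 2) =
      ∏ p ∈ s, (1 - ((redF (p : ℕ) P).card : ℝ) / ((p : ℕ) : ℝ)^2) := by
    simp only [G, Fintype.card_piFinset, hMdef]
    rw [Nat.cast_prod, Nat.cast_prod, ← Finset.prod_pow, one_div, ← Finset.prod_inv_distrib,
      ← Finset.prod_coe_sort s (fun p => (((p : ℕ) : ℝ) ^ 2)⁻¹), ← Finset.prod_mul_distrib,
      ← Finset.prod_coe_sort s]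
    refine Finset.prod_congr rfl fun p _ => ?_
    have hp : (((p : Nat.Primes) : ℕ) : ℝ) ≠ 0 := by exact_mod_cast (p : Nat.Primes).2.ne_zero
    rw [Finset.card_compl, Nat.cast_sub (Finset.card_le_univ _), Fintype.card_prod, ZMod.card]
    push_cast
    field_simp
  have h1 : Tendsto (fun R : ℝ => ∑ f ∈ G, ((cls M (a f) ∩ Bd R).ncard : ℝ) / R ^ 2) atTop
      (𝓝 (∑ f ∈ G, Real.pi * (1 / (M : ℝ) ^ 2))) :=
    tendsto_finsetSum _ fun f _ => cls_density M hM (a f)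
  have h2 := h1.div_const Real.pi
  rw [Finset.sum_const, nsmul_eq_mul, mul_left_comm, mul_div_cancel_left₀ _ Real.pi_ne_zero, hG] at h2
  refine h2.congr fun R => ?_
  rw [hcount, Nat.cast_sum, ← Finset.sum_div, div_div, mul_comm Real.pi]

noncomputable def boxF (k : ℕ) : Finset (ℤ × ℤ) :=
  (Finset.Icc (-(k : ℤ)) k ×ˢ Finset.Icc (-(k : ℤ)) k).erase 0

lemma boxF_card (k : ℕ) : (boxF k).card ≤ 8 * k ^ 2 := by
  unfold boxF
  rw [Finset.card_erase_of_mem (by simp), Finset.card_product, Int.card_Icc]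
  have : ((k : ℤ) + 1 - -(k : ℤ)).toNat = 2 * k + 1 := by omega
  rw [this]
  have : k ≤ k ^ 2 := Nat.le_self_pow two_ne_zero k
  have e : (2 * k + 1) * (2 * k + 1) = 4 * k ^ 2 + 4 * k + 1 := by ring
  omega

noncomputable def Zf (p : ℕ) (S : ℝ) : Finset (ℤ × ℤ) :=
  (boxF ⌊S / p⌋₊).image fun u => ((p : ℤ) * u.1, (p : ℤ) * u.2)

lemma Zf_card (p : ℕ) (S : ℝ) (hS : 0 ≤ S) :
    ((Zf p S).card : ℝ) ≤ 8 * S ^ 2 * (1 / (p : ℝ) ^ 2) := by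
  have h1 : (Zf p S).card ≤ 8 * ⌊S / p⌋₊ ^ 2 := Finset.card_image_le.trans (boxF_card _)
  have h2 : ((Zf p S).card : ℝ) ≤ 8 * (⌊S / p⌋₊ : ℝ) ^ 2 := by exact_mod_cast h1
  have h3 : (⌊S / p⌋₊ : ℝ) ≤ S / p := Nat.floor_le (by positivity)
  calc ((Zf p S).card : ℝ) ≤ 8 * (⌊S / p⌋₊ : ℝ) ^ 2 := h2
    _ ≤ 8 * (S / p) ^ 2 := by gcongr
    _ = _ := by ring

lemma mem_Zf (p : ℕ) (hp : 0 < p) (S : ℝ) (z : ℤ × ℤ) (hz : z ≠ 0)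
    (h1 : (p : ℤ) ∣ z.1) (h2 : (p : ℤ) ∣ z.2) (b1 : |(z.1 : ℝ)| ≤ S) (b2 : |(z.2 : ℝ)| ≤ S) :
    z ∈ Zf p S := by
  obtain ⟨u, hu⟩ := h1
  obtain ⟨v, hv⟩ := h2
  have hp' : (0 : ℝ) < p := by exact_mod_cast hp
  have key : ∀ w x : ℤ, x = p * w → |(x : ℝ)| ≤ S → w ∈ Finset.Icc (-((⌊S / p⌋₊ : ℕ) : ℤ)) (⌊S / p⌋₊ : ℕ) := by
    rintro w x rfl hx
    have : w.natAbs ≤ ⌊S / p⌋₊ := by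
      apply Nat.le_floor
      rw [le_div_iff₀ hp', Nat.cast_natAbs, Int.cast_abs]
      rw [Int.cast_mul, abs_mul, Int.cast_natCast, abs_of_pos hp'] at hx
      linarith
    rw [Finset.mem_Icc]
    omega
  refine Finset.mem_image.2 ⟨(u, v), ?_, ?_⟩
  · refine Finset.mem_erase.2 ⟨?_, Finset.mem_product.2 ⟨key _ _ hu b1, key _ _ hv b2⟩⟩
    intro h
    apply hz
    have hu0 : u = 0 := congrArg Prod.fst h
    have hv0 : v = 0 := congrArg Prod.snd h
    ext <;> simp [hu, hv, hu0, hv0]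
  · ext <;> simp [hu, hv]

def Av (P : Finset (ℤ × ℤ)) : Set (ℤ × ℤ) := {t | ∀ y ∈ P, y + t ∈ Vis}

lemma mem_redF_iff (p : ℕ) (P : Finset (ℤ × ℤ)) (t : ℤ × ℤ) :
    redP p (-t) ∈ redF p P ↔ ∃ y ∈ P, (p : ℤ) ∣ (y + t).1 ∧ (p : ℤ) ∣ (y + t).2 := by
  simp only [redF, redP, Finset.mem_image, Prod.mk.injEq, ← ZMod.intCast_zmod_eq_zero_iff_dvd]
  simp [eq_neg_iff_add_eq_zero]

lemma Av_sub (s : Finset Nat.Primes) (P : Finset (ℤ × ℤ)) : Av P ⊆ Asv s P := by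
  intro t ht p _ hmem
  obtain ⟨y, hy, h1, h2⟩ := (mem_redF_iff _ _ _).1 hmem
  have h : Int.gcd (y + t).1 (y + t).2 = 1 := ht y hy
  have := Int.dvd_coe_gcd h1 h2
  rw [h] at this
  have h3 : (p : ℕ) ∣ 1 := by exact_mod_cast this
  exact p.2.one_lt.ne' (Nat.dvd_one.1 h3)

lemma tail_bound (s : Finset Nat.Primes) (P : Finset (ℤ × ℤ)) (ρ R : ℝ) (hρ : 0 < ρ) (hR : 0 ≤ R)
    (hP : ∀ y ∈ P, (y.1 : ℝ) ^ 2 + (y.2 : ℝ) ^ 2 < ρ ^ 2) :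
    ∃ T : Finset Nat.Primes, Disjoint T s ∧
      ((Asv s P ∩ Bd R).ncard : ℝ) ≤ (Av P ∩ Bd R).ncard +
        P.card * (1 + 8 * (R + ρ) ^ 2 * ∑ p ∈ T, (1 / ((p : ℕ) : ℝ) ^ 2)) := by
  classical
  set S := R + ρ with hS
  have hS0 : 0 ≤ S := by positivity
  let T : Finset Nat.Primes := ((Finset.range (⌊S⌋₊ + 1)).subtype Nat.Prime).filter (fun p => p ∉ s)
  refine ⟨T, ?_, ?_⟩
  · rw [Finset.disjoint_left]
    intro p hp
    exact (Finset.mem_filter.1 hp).2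
  let E : Finset (ℤ × ℤ) :=
    P.biUnion fun y => insert (-y) (T.biUnion fun p => (Zf p S).image fun z => z - y)
  have hsub : Asv s P ∩ Bd R ⊆ (Av P ∩ Bd R) ∪ (E : Set (ℤ × ℤ)) := by
    rintro t ⟨ht, hB⟩
    by_cases hA : t ∈ Av P
    · exact Or.inl ⟨hA, hB⟩
    right
    simp only [Av, Set.mem_ofPred_eq, not_forall] at hA
    obtain ⟨y, hy, hv⟩ := hA
    rw [Finset.mem_coe, Finset.mem_biUnion]
    refine ⟨y, hy, ?_⟩
    by_cases hz : y + t = 0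
    · rw [Finset.mem_insert]; left
      exact (neg_eq_of_add_eq_zero_right hz).symm
    rw [Finset.mem_insert]; right
    have hv' : Int.gcd (y + t).1 (y + t).2 ≠ 1 := hv
    obtain ⟨p, hp, hpd⟩ := Nat.exists_prime_and_dvd hv'
    have hpd' : (p : ℤ) ∣ (Int.gcd (y + t).1 (y + t).2 : ℤ) := by exact_mod_cast hpd
    have d1 : (p : ℤ) ∣ (y + t).1 := hpd'.trans (Int.gcd_dvd_left ..)
    have d2 : (p : ℤ) ∣ (y + t).2 := hpd'.trans (Int.gcd_dvd_right ..)
    have hyb := hP y hy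
    have htb : (t.1 : ℝ) ^ 2 + (t.2 : ℝ) ^ 2 < R ^ 2 := hB
    have y1 : |(y.1 : ℝ)| ≤ ρ := abs_le_of_sq_le_sq (by nlinarith [sq_nonneg (y.2 : ℝ)]) hρ.le
    have y2 : |(y.2 : ℝ)| ≤ ρ := abs_le_of_sq_le_sq (by nlinarith [sq_nonneg (y.1 : ℝ)]) hρ.le
    have t1 : |(t.1 : ℝ)| ≤ R := abs_le_of_sq_le_sq (by nlinarith [sq_nonneg (t.2 : ℝ)]) hR
    have t2 : |(t.2 : ℝ)| ≤ R := abs_le_of_sq_le_sq (by nlinarith [sq_nonneg (t.1 : ℝ)]) hR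
    have b1 : |((y + t).1 : ℝ)| ≤ S := by
      rw [Prod.fst_add, Int.cast_add]
      exact (abs_add_le _ _).trans (by linarith)
    have b2 : |((y + t).2 : ℝ)| ≤ S := by
      rw [Prod.snd_add, Int.cast_add]
      exact (abs_add_le _ _).trans (by linarith)
    rw [Finset.mem_biUnion]
    refine ⟨⟨p, hp⟩, ?_, ?_⟩
    · refine Finset.mem_filter.2 ⟨?_, ?_⟩
      · have hle : (p : ℝ) ≤ S := by
          have aux : ∀ x : ℤ, x ≠ 0 → (p : ℤ) ∣ x → |(x : ℝ)| ≤ S → (p : ℝ) ≤ S := by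
            intro x hx hd hb
            have h1 : (p : ℤ) ≤ |x| := Int.le_of_dvd (abs_pos.2 hx) ((dvd_abs _ _).2 hd)
            have h2 : (p : ℝ) ≤ |(x : ℝ)| := by exact_mod_cast h1
            exact h2.trans hb
          by_cases h1 : (y + t).1 = 0
          · refine aux _ (fun h2 => hz (Prod.ext h1 h2)) d2 b2
          · exact aux _ h1 d1 b1
        refine Finset.mem_subtype.2 (Finset.mem_range.2 (Nat.lt_succ_of_le (Nat.le_floor hle)))
      · intro hs
        exact ht ⟨p, hp⟩ hs ((mem_redF_iff _ _ _).2 ⟨y, hy, d1, d2⟩)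
    · exact Finset.mem_image.2 ⟨y + t, mem_Zf p hp.pos S _ hz d1 d2 b1 b2, by abel⟩
  have hE : (E.card : ℝ) ≤ P.card * (1 + 8 * S ^ 2 * ∑ p ∈ T, (1 / ((p : ℕ) : ℝ) ^ 2)) := by
    have h1 : (E.card : ℝ) ≤ ∑ y ∈ P, (1 + ∑ p ∈ T, ((Zf p S).card : ℝ)) := by
      have : E.card ≤ ∑ y ∈ P, (1 + ∑ p ∈ T, (Zf p S).card) := by
        refine Finset.card_biUnion_le.trans (Finset.sum_le_sum fun y _ => ?_)
        refine (Finset.card_insert_le _ _).trans ?_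
        rw [add_comm]
        gcongr
        refine Finset.card_biUnion_le.trans (Finset.sum_le_sum fun p _ => ?_)
        exact Finset.card_image_le
      exact_mod_cast this
    refine h1.trans ?_
    rw [Finset.sum_const, nsmul_eq_mul, Finset.mul_sum]
    gcongr with p _
    exact Zf_card p S hS0
  have h1 : (Asv s P ∩ Bd R).ncard ≤ (Av P ∩ Bd R).ncard + E.card := by
    refine (Set.ncard_le_ncard hsub (((Bd_finite R).subset Set.inter_subset_right).union
      E.finite_toSet)).trans ((Set.ncard_union_le _ _).trans ?_)
    rw [Set.ncard_coe_finset]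
  have h2 : ((Asv s P ∩ Bd R).ncard : ℝ) ≤ (Av P ∩ Bd R).ncard + E.card := by exact_mod_cast h1
  linarith

lemma primes_summable : Summable (fun p : Nat.Primes => 1 / ((p : ℕ) : ℝ) ^ 2) :=
  (Real.summable_one_div_nat_pow.2 one_lt_two).comp_injective Subtype.val_injective

lemma patch_hasProd (P : Finset (ℤ × ℤ)) :
    HasProd (fun p : Nat.Primes => (1 - ((redF (p : ℕ) P).card : ℝ) / ((p : ℕ) : ℝ)^2))
      (∏' p : Nat.Primes, (1 - ((redF (p : ℕ) P).card : ℝ) / ((p : ℕ) : ℝ)^2)) := by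
  apply Multipliable.hasProd
  simp only [sub_eq_add_neg]
  apply Real.multipliable_one_add_of_summable
  apply Summable.neg
  refine Summable.of_nonneg_of_le (fun p => by positivity) (fun p => ?_)
    (primes_summable.mul_left (P.card : ℝ))
  rw [mul_one_div]
  gcongr
  exact Finset.card_image_le

lemma Av_density (P : Finset (ℤ × ℤ)) (ρ : ℝ) (hρ : 0 < ρ)
    (hP : ∀ y ∈ P, (y.1 : ℝ) ^ 2 + (y.2 : ℝ) ^ 2 < ρ ^ 2) :
    Tendsto (fun R : ℝ => ((Av P ∩ Bd R).ncard : ℝ) / (Real.pi * R ^ 2)) atTop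
      (𝓝 (∏' p : Nat.Primes, (1 - ((redF (p : ℕ) P).card : ℝ) / ((p : ℕ) : ℝ)^2))) := by
  rw [Metric.tendsto_nhds]
  intro ε hε
  set L := ∏' p : Nat.Primes, (1 - ((redF (p : ℕ) P).card : ℝ) / ((p : ℕ) : ℝ)^2) with hL
  set c : ℝ := (P.card : ℝ) with hc
  have hc0 : 0 ≤ c := by positivity
  have hδ : 0 < ε / 4 / (32 * (c + 1)) := by positivity
  obtain ⟨s0, hs0⟩ := summable_iff_vanishing_norm.1 primes_summable _ hδ
  have hprod := (patch_hasProd P)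
  rw [HasProd, SummationFilter.unconditional_filter] at hprod
  obtain ⟨s, hs1, hs2⟩ := (((Metric.tendsto_nhds.1 hprod) (ε / 4) (by positivity)).and
    (eventually_ge_atTop s0)).exists
  have hA := (Metric.tendsto_nhds.1 (Asv_density s P)) (ε / 4) (by positivity)
  have hz : Tendsto (fun R : ℝ => c / R ^ 2) atTop (𝓝 0) :=
    tendsto_const_nhds.div_atTop (tendsto_pow_atTop two_ne_zero)
  have hz' := hz.eventually_lt_const (show (0 : ℝ) < ε / 4 by positivity)
  filter_upwards [hA, hz', eventually_ge_atTop ρ] with R h1 h2 h3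
  have hR : 0 < R := hρ.trans_le h3
  obtain ⟨T, hT, hb⟩ := tail_bound s P ρ R hρ hR.le hP
  have hsum := hs0 T (hT.mono_right hs2)
  set σ := ∑ p ∈ T, (1 / ((p : ℕ) : ℝ) ^ 2) with hσ
  have hσ0 : 0 ≤ σ := Finset.sum_nonneg fun p _ => by positivity
  have hσ1 : σ < ε / 4 / (32 * (c + 1)) := (le_abs_self _).trans_lt hsum
  have hle : ((Av P ∩ Bd R).ncard : ℝ) ≤ (Asv s P ∩ Bd R).ncard := by
    exact_mod_cast Set.ncard_le_ncard (Set.inter_subset_inter_left _ (Av_sub s P))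
      ((Bd_finite R).subset Set.inter_subset_right)
  have hpi : 1 ≤ Real.pi := by linarith [Real.pi_gt_three]
  set X := ((Av P ∩ Bd R).ncard : ℝ) / (Real.pi * R ^ 2) with hX
  set Y := ((Asv s P ∩ Bd R).ncard : ℝ) / (Real.pi * R ^ 2) with hY
  have hXY : X ≤ Y := by rw [hX, hY]; gcongr
  have hYX : Y ≤ X + (c / R ^ 2 + 32 * c * σ) := by
    have hq : c * (1 + 8 * (R + ρ) ^ 2 * σ) / (Real.pi * R ^ 2) ≤ c / R ^ 2 + 32 * c * σ := by
      calc c * (1 + 8 * (R + ρ) ^ 2 * σ) / (Real.pi * R ^ 2)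
          ≤ c * (1 + 8 * (R + R) ^ 2 * σ) / (1 * R ^ 2) := by gcongr
        _ = c / R ^ 2 + 32 * c * σ := by field_simp; ring
    have : Y ≤ X + c * (1 + 8 * (R + ρ) ^ 2 * σ) / (Real.pi * R ^ 2) := by
      rw [hX, hY, ← add_div]; gcongr
    linarith
  have h5 : 32 * c * σ ≤ ε / 4 := by
    rw [lt_div_iff₀ (by positivity)] at hσ1
    nlinarith
  rw [Real.dist_eq, abs_lt] at *
  constructor <;> linarith [h1.1, h1.2, hs1.1, hs1.2]

end PatchDensity

/-- For any `ρ`-patch `P` of the visible points, the natural density of the set of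
translations `t` whose `ρ`-patch contains `P` exists and equals `∏_p (1 − |P_p|/p²)`. -/
theorem visible_patch_containment_density (ρ : ℝ) (hρ : 0 < ρ) (P : Finset (ℤ × ℤ))
    (hP : ∃ t : ℤ × ℤ, ∀ y : ℤ × ℤ,
      y ∈ P ↔ (y + t ∈ Vis ∧ (y.1 : ℝ)^2 + (y.2 : ℝ)^2 < ρ^2)) :
    Tendsto (fun R : ℝ =>
        (Nat.card {t : ℤ × ℤ //
          (∀ y ∈ P, y + t ∈ Vis ∧ (y.1 : ℝ)^2 + (y.2 : ℝ)^2 < ρ^2) ∧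
          (t.1 : ℝ)^2 + (t.2 : ℝ)^2 < R^2} : ℝ) / (Real.pi * R^2))
      atTop
      (𝓝 (∏' p : Nat.Primes, (1 - ((redF (p : ℕ) P).card : ℝ) / ((p : ℕ) : ℝ)^2))) := by
  obtain ⟨t₀, ht₀⟩ := hP
  have hb : ∀ y ∈ P, (y.1 : ℝ) ^ 2 + (y.2 : ℝ) ^ 2 < ρ ^ 2 := fun y hy => ((ht₀ y).1 hy).2
  refine (PatchDensity.Av_density P ρ hρ hb).congr fun R => ?_
  congr 2
  refine Nat.card_congr (Equiv.subtypeEquivRight fun t => ?_)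
  constructor
  · rintro ⟨h1, h2⟩
    exact ⟨fun y hy => ⟨h1 y hy, hb y hy⟩, h2⟩
  · rintro ⟨h1, h2⟩
    exact ⟨fun y hy => (h1 y hy).1, h2⟩
end

section
/- Let G be a finite additive group and let P, Q be subsets of G. For S ⊆ P set Q_S = (⋂_{s ∈ S} (Q − s)) \ (⋃_{s ∈ P \ S} (Q − s)), with the convention that the intersection over the empty index set is G. Then Σ_{S ⊆ P} |S| · |Q_S| = |P| · |Q|. -/
/-- For a finite additive group `G` and finite subsets `P, Q ⊆ G`, with
`Q_S = (⋂_{s∈S}(Q−s)) \ (⋃_{s∈P\S}(Q−s))` for `S ⊆ P` (empty intersection read as `G`),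
one has `Σ_{S⊆P} |S|·|Q_S| = |P|·|Q|`. -/
theorem sum_card_translates (G : Type*) [AddGroup G] [Fintype G] [DecidableEq G]
    (P Q : Finset G) :
    ∑ S ∈ P.powerset, S.card *
      (Finset.univ.filter (fun g : G =>
        (∀ s ∈ S, g + s ∈ Q) ∧ (∀ s ∈ P \ S, g + s ∉ Q))).card
    = P.card * Q.card := by
  have h1 : ∀ S ∈ P.powerset, S.card *
      (Finset.univ.filter (fun g : G =>
        (∀ s ∈ S, g + s ∈ Q) ∧ (∀ s ∈ P \ S, g + s ∉ Q))).card
      = ∑ g : G, if S = P.filter (fun s => g + s ∈ Q) then S.card else 0 := by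
    intro S hS
    rw [Finset.mem_powerset] at hS
    rw [Finset.card_filter, Finset.mul_sum]
    refine Finset.sum_congr rfl fun g _ => ?_
    have : ((∀ s ∈ S, g + s ∈ Q) ∧ (∀ s ∈ P \ S, g + s ∉ Q)) ↔
        S = P.filter (fun s => g + s ∈ Q) := by
      constructor
      · rintro ⟨ha, hb⟩
        ext s
        rw [Finset.mem_filter]
        constructor
        · intro hs
          exact ⟨hS hs, ha s hs⟩
        · rintro ⟨hp, hq⟩
          by_contra hs
          exact hb s (Finset.mem_sdiff.2 ⟨hp, hs⟩) hq
      · intro h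
        constructor
        · intro s hs
          rw [h, Finset.mem_filter] at hs
          exact hs.2
        · intro s hs hq
          rw [Finset.mem_sdiff] at hs
          apply hs.2
          rw [h, Finset.mem_filter]
          exact ⟨hs.1, hq⟩
    simp only [this, mul_ite, mul_one, mul_zero]
  rw [Finset.sum_congr rfl h1, Finset.sum_comm]
  have h2 : ∀ g : G, (∑ S ∈ P.powerset,
      if S = P.filter (fun s => g + s ∈ Q) then S.card else 0)
      = ∑ s ∈ P, if g + s ∈ Q then 1 else 0 := by
    intro g
    rw [Finset.sum_ite_eq', if_pos (Finset.mem_powerset.2 (Finset.filter_subset _ _)),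
      Finset.card_filter]
  rw [Finset.sum_congr rfl fun g _ => h2 g, Finset.sum_comm]
  have h3 : ∀ s ∈ P, (∑ g : G, if g + s ∈ Q then 1 else 0) = Q.card := by
    intro s _
    refine (Equiv.sum_comp (Equiv.addRight s) (fun g => if g ∈ Q then 1 else 0)).trans ?_
    simp
  rw [Finset.sum_congr rfl h3, Finset.sum_const, smul_eq_mul]
end

section
/- For any finite admissible subsets P and Q of ℤ², one has lim_{R→∞} (1/(π R²)) Σ_{x ∈ ℤ² ∩ B_R(0)} ∏_p (1 − |((x + P) ∪ Q)_p| / p²) = (∏_p (1 − |P_p|/p²)) · (∏_p (1 − |Q_p|/p²)), all products running over all primes p. (This identity expresses the ergodicity of the patch frequency measure ν on the hull of the visible points, via ν(B_P) = ∏_p (1 − |P_p|/p²).) -/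
open Filter Topology

/-- Lattice points in the open disc of radius `R`. -/
noncomputable def discF (R : ℝ) : Finset (ℤ × ℤ) :=
  (Finset.Icc (-⌈|R|⌉) ⌈|R|⌉ ×ˢ Finset.Icc (-⌈|R|⌉) ⌈|R|⌉).filter
    fun x => (x.1 : ℝ)^2 + (x.2 : ℝ)^2 < R^2

lemma mem_discF (R : ℝ) (x : ℤ × ℤ) :
    x ∈ discF R ↔ (x.1 : ℝ)^2 + (x.2 : ℝ)^2 < R^2 := by
  have key : ∀ a b : ℤ, (a : ℝ)^2 + (b : ℝ)^2 < R^2 → -⌈|R|⌉ ≤ a ∧ a ≤ ⌈|R|⌉ := by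
    intro a b h
    have h1 : |(a : ℝ)| < |R| := sq_lt_sq.mp (by nlinarith [sq_nonneg (b : ℝ)])
    have h2 := Int.le_ceil |R|
    have h3 := abs_lt.mp h1
    constructor
    · have : -((⌈|R|⌉ : ℤ) : ℝ) ≤ a := by linarith
      exact_mod_cast this
    · have : (a : ℝ) ≤ ((⌈|R|⌉ : ℤ) : ℝ) := by linarith
      exact_mod_cast this
  unfold discF
  rw [Finset.mem_filter, Finset.mem_product, Finset.mem_Icc, Finset.mem_Icc]
  constructor
  · exact fun h => h.2
  · intro h
    exact ⟨⟨key _ _ h, key _ x.1 (by linarith)⟩, h⟩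

lemma unit_disc_volume :
    MeasureTheory.volume.real {v : Fin 2 → ℝ | v 0 ^ 2 + v 1 ^ 2 < 1} = Real.pi := by
  have h := (PiLp.volume_preserving_toLp (Fin 2)).measure_preimage
    (s := Metric.ball (0 : EuclideanSpace ℝ (Fin 2)) 1) measurableSet_ball.nullMeasurableSet
  have hs : {v : Fin 2 → ℝ | v 0 ^ 2 + v 1 ^ 2 < 1} =
      (@WithLp.toLp 2 (Fin 2 → ℝ)) ⁻¹' (Metric.ball (0 : EuclideanSpace ℝ (Fin 2)) 1) := by
    ext v
    simp [EuclideanSpace.norm_eq, Real.sqrt_lt', Fin.sum_univ_two]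
  rw [MeasureTheory.measureReal_def, hs, h, EuclideanSpace.volume_ball_fin_two]
  simp [Real.pi_pos.le]

lemma unit_disc_convex : Convex ℝ {v : Fin 2 → ℝ | v 0 ^ 2 + v 1 ^ 2 < 1} := by
  intro v hv w hw a b ha hb hab
  simp only [Set.mem_ofPred_eq, Pi.add_apply, Pi.smul_apply, smul_eq_mul] at *
  have hb' : b = 1 - a := by linarith
  subst hb'
  by_cases h0 : a = 0
  · subst h0; simpa using hw
  have ha' : 0 < a := lt_of_le_of_ne ha (Ne.symm h0)
  nlinarith [mul_nonneg (mul_nonneg ha hb) (sq_nonneg (v 0 - w 0)),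
    mul_nonneg (mul_nonneg ha hb) (sq_nonneg (v 1 - w 1)), mul_pos ha' (sub_pos.mpr hv),
    mul_nonneg hb (sub_pos.mpr hw).le]

open scoped Pointwise in
lemma discF_card_tendsto :
    Tendsto (fun R : ℝ => ((discF R).card : ℝ) / (Real.pi * R^2)) atTop (𝓝 1) := by
  set s : Set (Fin 2 → ℝ) := {v : Fin 2 → ℝ | v 0 ^ 2 + v 1 ^ 2 < 1} with hs
  have hopen : IsOpen s := isOpen_lt (by fun_prop) (by fun_prop)
  have hb : Bornology.IsBounded s := by
    refine (Metric.isBounded_closedBall (x := (0 : Fin 2 → ℝ)) (r := 1)).subset ?_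
    intro v hv
    simp only [hs, Set.mem_ofPred_eq] at hv
    rw [mem_closedBall_zero_iff, pi_norm_le_iff_of_nonneg zero_le_one]
    intro i
    rw [Real.norm_eq_abs, ← sq_le_one_iff_abs_le_one]
    fin_cases i
    · change v 0 ^ 2 ≤ 1
      nlinarith [sq_nonneg (v 1)]
    · change v 1 ^ 2 ≤ 1
      nlinarith [sq_nonneg (v 0)]
  have hmono : ∀ ⦃x y : ℝ⦄, 0 < x → x ≤ y → x • s ⊆ y • s := by
    intro x y hx hxy v hv
    have hy : 0 < y := hx.trans_le hxy
    rw [Set.mem_smul_set_iff_inv_smul_mem₀ hx.ne'] at hv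
    rw [Set.mem_smul_set_iff_inv_smul_mem₀ hy.ne']
    simp only [hs, Set.mem_ofPred_eq, Pi.smul_apply, smul_eq_mul, mul_pow] at *
    rw [← mul_add] at *
    refine lt_of_le_of_lt ?_ hv
    gcongr
  have h := tendsto_card_div_pow_atTop_volume' s hb hopen.measurableSet
    (unit_disc_convex.addHaar_frontier _) hmono
  rw [unit_disc_volume] at h
  have h2 := h.div_const Real.pi
  rw [div_self Real.pi_ne_zero] at h2
  refine h2.congr' ?_
  filter_upwards [eventually_gt_atTop 0] with R hR
  have hc : Nat.card ↑(s ∩ R⁻¹ • (Submodule.span ℤ (Set.range (Pi.basisFun ℝ (Fin 2))) :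
      Set (Fin 2 → ℝ))) = (discF R).card := by
    have himg : (s ∩ R⁻¹ • (Submodule.span ℤ (Set.range (Pi.basisFun ℝ (Fin 2))) :
      Set (Fin 2 → ℝ))) = (fun x : ℤ × ℤ => (![R⁻¹ * x.1, R⁻¹ * x.2] : Fin 2 → ℝ)) ''
        (discF R : Set (ℤ × ℤ)) := by
      have hsq : ∀ a b : ℝ, (R⁻¹ * a)^2 + (R⁻¹ * b)^2 < 1 ↔ a^2 + b^2 < R^2 := by
        intro a b
        rw [mul_pow, mul_pow, ← mul_add, inv_pow, inv_mul_lt_iff₀ (by positivity), mul_one]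
      ext v
      rw [Set.mem_inter_iff, Set.mem_smul_set_iff_inv_smul_mem₀ (inv_ne_zero hR.ne'), inv_inv,
        SetLike.mem_coe, Module.Basis.mem_span_iff_repr_mem]
      simp only [hs, Set.mem_ofPred_eq, Pi.basisFun_repr, Pi.smul_apply, smul_eq_mul,
        Fin.forall_fin_two, Set.mem_range, Set.mem_image, Finset.mem_coe, mem_discF,
        algebraMap_int_eq, eq_intCast]
      constructor
      · rintro ⟨h1, ⟨a, ha⟩, ⟨b, hb⟩⟩
        have e0 : v 0 = R⁻¹ * a := by rw [ha]; field_simp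
        have e1 : v 1 = R⁻¹ * b := by rw [hb]; field_simp
        refine ⟨(a, b), ?_, ?_⟩
        · rw [e0, e1, hsq] at h1; exact h1
        · ext i; fin_cases i
          · simp [e0]
          · simp [e1]
      · rintro ⟨x, hx, rfl⟩
        refine ⟨?_, ⟨x.1, ?_⟩, ⟨x.2, ?_⟩⟩
        · simpa using (hsq _ _).mpr hx
        · simp; field_simp
        · simp; field_simp
    rw [himg, Nat.card_image_of_injective]
    · simp
    · intro x y hxy
      have h0 := congrFun hxy 0
      have h1 := congrFun hxy 1
      simp [hR.ne'] at h0 h1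
      exact Prod.ext h0 h1
  rw [hc]
  simp only [Fintype.card_fin]
  rw [div_div, mul_comm]

lemma discF_shift (F : ℤ × ℤ → ℝ) (hF : ∀ x, 0 ≤ F x) (t : ℤ × ℤ) (m : ℝ)
    (h1 : |(t.1 : ℝ)| ≤ m) (h2 : |(t.2 : ℝ)| ≤ m) (R : ℝ) (hR : 0 < R) :
    ∑ x ∈ discF R, F (x + t) ≤ ∑ x ∈ discF (R + 2 * m), F x := by
  have e : ∑ x ∈ discF R, F (x + t) =
      ∑ x ∈ (discF R).map (Equiv.addRight t).toEmbedding, F x := by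
    rw [Finset.sum_map]; rfl
  rw [e]
  refine Finset.sum_le_sum_of_subset_of_nonneg ?_ (fun x _ _ => hF x)
  intro y hy
  rw [Finset.mem_map] at hy
  obtain ⟨x, hx, rfl⟩ := hy
  rw [mem_discF] at hx
  rw [mem_discF]
  simp only [Equiv.coe_toEmbedding, Equiv.coe_addRight, Prod.fst_add, Prod.snd_add, Int.cast_add]
  have hm : 0 ≤ m := (abs_nonneg _).trans h1
  have a1 : |(x.1 : ℝ)| ≤ R := abs_le_of_sq_le_sq (by nlinarith [sq_nonneg (x.2 : ℝ)]) hR.le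
  have a2 : |(x.2 : ℝ)| ≤ R := abs_le_of_sq_le_sq (by nlinarith [sq_nonneg (x.1 : ℝ)]) hR.le
  have b1 : (x.1 : ℝ) * t.1 ≤ R * m := (le_abs_self _).trans (by rw [abs_mul]; gcongr)
  have b2 : (x.2 : ℝ) * t.2 ≤ R * m := (le_abs_self _).trans (by rw [abs_mul]; gcongr)
  have c1 : (t.1 : ℝ)^2 ≤ m^2 := sq_le_sq.mpr (by rwa [abs_of_nonneg hm])
  have c2 : (t.2 : ℝ)^2 ≤ m^2 := sq_le_sq.mpr (by rwa [abs_of_nonneg hm])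
  nlinarith

lemma discF_card_shift_tendsto (c : ℝ) :
    Tendsto (fun R : ℝ => ((discF (R + c)).card : ℝ) / (Real.pi * R^2)) atTop (𝓝 1) := by
  have h1 := discF_card_tendsto.comp (tendsto_atTop_add_const_right atTop c tendsto_id)
  have h2 : Tendsto (fun R : ℝ => (1 + c / R)^2) atTop (𝓝 1) := by
    have : Tendsto (fun R : ℝ => c / R) atTop (𝓝 0) := tendsto_const_nhds.div_atTop tendsto_id
    simpa using (this.const_add 1).pow 2
  have h3 := h1.mul h2
  rw [one_mul] at h3
  refine h3.congr' ?_
  filter_upwards [eventually_gt_atTop 0, eventually_gt_atTop (-c)] with R hR hRc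
  have : 0 < R + c := by linarith
  have := Real.pi_pos
  simp only [Function.comp, id]
  field_simp

lemma periodic_avg (F : ℤ × ℤ → ℝ) (hF : ∀ x, 0 ≤ F x) (m : ℕ) [NeZero m]
    (G : ZMod m × ZMod m → ℝ) (hG : ∀ x : ℤ × ℤ, F x = G ((x.1 : ZMod m), (x.2 : ZMod m))) :
    Tendsto (fun R : ℝ => (∑ x ∈ discF R, F x) / (Real.pi * R^2)) atTop
      (𝓝 ((∑ g, G g) / (m : ℝ)^2)) := by
  have hm : (0 : ℝ) < m := by exact_mod_cast Nat.pos_of_neZero m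
  let τ : ZMod m × ZMod m → ℤ × ℤ := fun t => ((t.1.val : ℤ), (t.2.val : ℤ))
  have hτ : ∀ t : ZMod m × ZMod m, |((τ t).1 : ℝ)| ≤ m ∧ |((τ t).2 : ℝ)| ≤ m := by
    intro t
    constructor
    · simp only [τ, Int.cast_natCast, Nat.abs_cast, Nat.cast_le]; exact (ZMod.val_lt _).le
    · simp only [τ, Int.cast_natCast, Nat.abs_cast, Nat.cast_le]; exact (ZMod.val_lt _).le
  have hsum : ∀ R : ℝ, ∑ t : ZMod m × ZMod m, ∑ x ∈ discF R, F (x + τ t) =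
      (discF R).card * ∑ g, G g := by
    intro R
    rw [Finset.sum_comm, ← nsmul_eq_mul, ← Finset.sum_const]
    refine Finset.sum_congr rfl fun x _ => ?_
    rw [← Equiv.sum_comp (Equiv.addLeft (((x.1 : ZMod m), (x.2 : ZMod m)) : ZMod m × ZMod m)) G]
    refine Finset.sum_congr rfl fun t _ => ?_
    rw [hG]
    congr 1
    simp [τ, Prod.ext_iff]
  have hcard : ∀ c : ℝ, ∑ t : ZMod m × ZMod m, c = (m : ℝ)^2 * c := by
    intro c
    simp [ZMod.card, sq]
  have up : ∀ R : ℝ, 2 * m < R → ∑ x ∈ discF R, F x ≤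
      (discF (R + 2 * m)).card * ((∑ g, G g) / (m : ℝ)^2) := by
    intro R hR
    have : ∑ t : ZMod m × ZMod m, ∑ x ∈ discF R, F x ≤
        ∑ t : ZMod m × ZMod m, ∑ x ∈ discF (R + 2 * m), F (x + τ t) := by
      refine Finset.sum_le_sum fun t _ => ?_
      have := discF_shift (fun x => F (x + τ t)) (fun x => hF _) (-τ t) m
        (by simpa using (hτ t).1) (by simpa using (hτ t).2) R (by linarith)
      simpa using this
    rw [hsum, hcard] at this
    rw [mul_div_assoc', le_div_iff₀ (by positivity)]
    linarith
  have lo : ∀ R : ℝ, 2 * m < R → 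
      (discF (R + -(2 * m))).card * ((∑ g, G g) / (m : ℝ)^2) ≤ ∑ x ∈ discF R, F x := by
    intro R hR
    have : ∑ t : ZMod m × ZMod m, ∑ x ∈ discF (R + -(2 * m)), F (x + τ t) ≤
        ∑ t : ZMod m × ZMod m, ∑ x ∈ discF R, F x := by
      refine Finset.sum_le_sum fun t _ => ?_
      have := discF_shift F hF (τ t) m (hτ t).1 (hτ t).2 (R + -(2 * m)) (by linarith)
      simpa using this
    rw [hsum, hcard] at this
    rw [mul_div_assoc', div_le_iff₀ (by positivity)]
    linarith
  have l1 := (discF_card_shift_tendsto (-(2 * m))).mul_const ((∑ g, G g) / (m : ℝ)^2)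
  have l2 := (discF_card_shift_tendsto (2 * m)).mul_const ((∑ g, G g) / (m : ℝ)^2)
  rw [one_mul] at l1 l2
  refine tendsto_of_tendsto_of_tendsto_of_le_of_le' l1 l2 ?_ ?_
  · filter_upwards [eventually_gt_atTop (2 * (m : ℝ))] with R hR
    rw [div_mul_eq_mul_div]
    have := lo R hR
    have := Real.pi_pos
    gcongr
  · filter_upwards [eventually_gt_atTop (2 * (m : ℝ))] with R hR
    rw [div_mul_eq_mul_div]
    have := up R hR
    have := Real.pi_pos
    gcongr

lemma crt_mean (g : (p : ℕ) → ZMod p × ZMod p → ℝ) (S : Finset Nat.Primes) :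
    ∃ (m : ℕ) (_ : NeZero m) (G : ZMod m × ZMod m → ℝ), m = ∏ p ∈ S, (p : ℕ) ∧
      (∀ x : ℤ × ℤ, G ((x.1 : ZMod m), (x.2 : ZMod m)) =
        ∏ p ∈ S, g p ((x.1 : ZMod p), (x.2 : ZMod p))) ∧
      (∑ y, G y) / (m : ℝ)^2 = ∏ p ∈ S,
        (haveI : NeZero (p : ℕ) := ⟨p.2.ne_zero⟩; (∑ y, g p y) / ((p : ℕ) : ℝ)^2) := by
  classical
  induction S using Finset.induction_on with
  | empty => exact ⟨1, inferInstance, fun _ => 1, by simp, by simp, by simp⟩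
  | insert q S hq ih =>
    obtain ⟨m, hm, G, hmS, hG, hmean⟩ := ih
    haveI : NeZero (q : ℕ) := ⟨q.2.ne_zero⟩
    have hco : (q : ℕ).Coprime m := by
      rw [hmS]
      refine Nat.Coprime.prod_right fun p hp => ?_
      refine (Nat.coprime_primes q.2 p.2).mpr fun h => hq ?_
      rwa [show q = p from Subtype.ext h]
    haveI : NeZero ((q : ℕ) * m) := ⟨mul_ne_zero q.2.ne_zero hm.ne⟩
    let e := ZMod.chineseRemainder hco
    refine ⟨q * m, inferInstance,
      fun y => g q ((e y.1).1, (e y.2).1) * G ((e y.1).2, (e y.2).2), ?_, ?_, ?_⟩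
    · rw [Finset.prod_insert hq, hmS]
    · intro x
      rw [Finset.prod_insert hq, ← hG]
      simp
    · rw [Finset.prod_insert hq, ← hmean]
      let E : ZMod (q * m) × ZMod (q * m) ≃ (ZMod q × ZMod q) × (ZMod m × ZMod m) :=
        (Equiv.prodCongr e.toEquiv e.toEquiv).trans (Equiv.prodProdProdComm _ _ _ _)
      have : ∑ y : ZMod (q * m) × ZMod (q * m),
          g q ((e y.1).1, (e y.2).1) * G ((e y.1).2, (e y.2).2) =
          ∑ z : (ZMod q × ZMod q) × (ZMod m × ZMod m), g q z.1 * G z.2 := by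
        rw [← Equiv.sum_comp E]
        rfl
      rw [this, Fintype.sum_prod_type, ← Finset.sum_mul_sum]
      push_cast
      rw [mul_pow, mul_div_mul_comm]

lemma local_mean {A : Type*} [AddCommGroup A] [Fintype A] [DecidableEq A] (B C : Finset A) :
    (∑ g : A, (1 - (((B.image fun b => g + b) ∪ C).card : ℝ) / (Fintype.card A : ℝ))) /
      (Fintype.card A : ℝ) =
    (1 - (B.card : ℝ) / (Fintype.card A : ℝ)) * (1 - (C.card : ℝ) / (Fintype.card A : ℝ)) := by
  have hn : (Fintype.card A : ℝ) ≠ 0 := by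
    exact_mod_cast Fintype.card_ne_zero
  have h1 : ∀ g : A, (((B.image fun b => g + b) ∪ C).card : ℝ) =
      B.card + C.card - ∑ b ∈ B, if g + b ∈ C then (1 : ℝ) else 0 := by
    intro g
    have hinj : Function.Injective fun b : A => g + b := add_right_injective g
    have := Finset.card_union_add_card_inter (B.image fun b => g + b) C
    rw [Finset.card_image_of_injective _ hinj] at this
    have h2 : ((B.image fun b => g + b) ∩ C).card = (B.filter fun b => g + b ∈ C).card := by
      rw [← Finset.card_image_of_injective (B.filter fun b => g + b ∈ C) hinj]
      congr 1
      ext y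
      simp only [Finset.mem_inter, Finset.mem_image, Finset.mem_filter]
      constructor
      · rintro ⟨⟨b, hb, rfl⟩, hy⟩; exact ⟨b, ⟨hb, hy⟩, rfl⟩
      · rintro ⟨b, ⟨hb, hy⟩, rfl⟩; exact ⟨⟨b, hb, rfl⟩, hy⟩
    rw [Finset.sum_boole, ← h2, eq_sub_iff_add_eq]
    exact_mod_cast this
  have h3 : ∑ g : A, ∑ b ∈ B, (if g + b ∈ C then (1 : ℝ) else 0) = B.card * C.card := by
    rw [Finset.sum_comm, ← nsmul_eq_mul, ← Finset.sum_const]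
    refine Finset.sum_congr rfl fun b _ => ?_
    refine (Equiv.sum_comp (Equiv.addRight b) (fun y => if y ∈ C then (1 : ℝ) else 0)).trans ?_
    simp
  simp_rw [h1]
  rw [Finset.sum_sub_distrib, ← Finset.sum_div, Finset.sum_sub_distrib, h3]
  simp only [Finset.sum_const, Finset.card_univ, nsmul_eq_mul]
  field_simp
  ring

lemma one_sub_prod_le {ι : Type*} (T : Finset ι) (h u : ι → ℝ)
    (h0 : ∀ i, 0 ≤ h i) (h1 : ∀ i, h i ≤ 1) (hu : ∀ i, 1 - u i ≤ h i) :
    1 - ∏ i ∈ T, h i ≤ ∑ i ∈ T, u i := by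
  classical
  induction T using Finset.induction_on with
  | empty => simp
  | insert a T ha ih =>
    rw [Finset.prod_insert ha, Finset.sum_insert ha]
    have hp : ∏ i ∈ T, h i ≤ 1 := Finset.prod_le_one (fun i _ => h0 i) (fun i _ => h1 i)
    have hp0 : 0 ≤ ∏ i ∈ T, h i := Finset.prod_nonneg (fun i _ => h0 i)
    nlinarith [hu a, h0 a, h1 a]

lemma prod_mult {ι : Type*} (h u : ι → ℝ) (hsu : Summable u)
    (h1 : ∀ i, h i ≤ 1) (hu : ∀ i, 1 - u i ≤ h i) : Multipliable h := by
  have : Summable fun i => ‖h i - 1‖ := by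
    refine Summable.of_nonneg_of_le (fun i => norm_nonneg _) (fun i => ?_) hsu
    rw [Real.norm_eq_abs, abs_le]
    constructor <;> linarith [h1 i, hu i]
  simpa using multipliable_one_add_of_summable this

lemma prod_tail {ι : Type*} (h u : ι → ℝ) (hsu : Summable u) (S : Finset ι) (ε : ℝ)
    (hS : ∀ T : Finset ι, Disjoint T S → ∑ i ∈ T, u i ≤ ε)
    (h0 : ∀ i, 0 ≤ h i) (h1 : ∀ i, h i ≤ 1) (hu : ∀ i, 1 - u i ≤ h i) :
    |∏' i, h i - ∏ i ∈ S, h i| ≤ ε := by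
  classical
  have hp : Tendsto (fun T : Finset ι => ∏ i ∈ T, h i) atTop (𝓝 (∏' i, h i)) :=
    (prod_mult h u hsu h1 hu).hasProd
  have hlim := (hp.sub_const (∏ i ∈ S, h i)).abs
  refine le_of_tendsto hlim ?_
  filter_upwards [eventually_ge_atTop S] with T hT
  have hST : S ⊆ T := hT
  rw [← Finset.prod_sdiff hST]
  have a1 := one_sub_prod_le (T \ S) h u h0 h1 hu
  have a2 := hS (T \ S) Finset.sdiff_disjoint
  have b1 : ∏ i ∈ T \ S, h i ≤ 1 := Finset.prod_le_one (fun i _ => h0 i) (fun i _ => h1 i)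
  have b2 : 0 ≤ ∏ i ∈ S, h i := Finset.prod_nonneg (fun i _ => h0 i)
  have b3 : ∏ i ∈ S, h i ≤ 1 := Finset.prod_le_one (fun i _ => h0 i) (fun i _ => h1 i)
  rw [abs_le]
  constructor <;> nlinarith

lemma redF_union (p : ℕ) (P Q : Finset (ℤ × ℤ)) (x : ℤ × ℤ) :
    redF p ((P.image fun y => x + y) ∪ Q) =
      ((redF p P).image fun b => ((x.1 : ZMod p), (x.2 : ZMod p)) + b) ∪ redF p Q := by
  unfold redF
  rw [Finset.image_union, Finset.image_image, Finset.image_image]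
  congr 2
  funext y
  simp

lemma redF_card_le (p : ℕ) (P : Finset (ℤ × ℤ)) : (redF p P).card ≤ P.card :=
  Finset.card_image_le

lemma redF_card_le_sq (p : ℕ) (hp : p.Prime) (P : Finset (ℤ × ℤ)) :
    ((redF p P).card : ℝ) ≤ (p : ℝ)^2 := by
  haveI : NeZero p := ⟨hp.ne_zero⟩
  have := Finset.card_le_univ (redF p P)
  rw [Fintype.card_prod, ZMod.card, ← sq] at this
  exact_mod_cast this

lemma summable_primes_sq (C : ℝ) : Summable fun p : Nat.Primes => C / ((p : ℕ) : ℝ)^2 := by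
  have h : Summable fun n : ℕ => C / (n : ℝ)^2 := by
    simpa [div_eq_mul_inv] using (Real.summable_nat_pow_inv.mpr one_lt_two).mul_left C
  exact h.comp_injective (i := fun p : Nat.Primes => (p : ℕ)) Subtype.val_injective

/-- Ergodicity identity for the patch frequency measure: for finite admissible `P, Q ⊆ ℤ²`,
`lim_{R→∞} (1/(πR²)) Σ_{x∈ℤ²∩B_R(0)} ∏_p (1 − |((x+P)∪Q)_p|/p²)
  = ∏_p (1 − |P_p|/p²) · ∏_p (1 − |Q_p|/p²)`. -/
theorem patch_frequency_measure_ergodic (P Q : Finset (ℤ × ℤ))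
    (hP : ∀ p : ℕ, p.Prime → (redF p P).card < p^2)
    (hQ : ∀ p : ℕ, p.Prime → (redF p Q).card < p^2) :
    Tendsto (fun R : ℝ =>
      (∑' x : ℤ × ℤ,
        if (x.1 : ℝ)^2 + (x.2 : ℝ)^2 < R^2 then
          ∏' p : Nat.Primes,
            (1 - ((redF (p : ℕ) ((P.image fun y => x + y) ∪ Q)).card : ℝ) / ((p : ℕ) : ℝ)^2)
        else 0) / (Real.pi * R^2))
      atTop
      (𝓝 ((∏' p : Nat.Primes, (1 - ((redF (p : ℕ) P).card : ℝ) / ((p : ℕ) : ℝ)^2)) *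
          (∏' p : Nat.Primes, (1 - ((redF (p : ℕ) Q).card : ℝ) / ((p : ℕ) : ℝ)^2)))) := by
  classical
  set C : ℝ := P.card + Q.card with hC
  set u : Nat.Primes → ℝ := fun p => C / ((p : ℕ) : ℝ)^2 with hu
  have hsu : Summable u := summable_primes_sq C
  have hpos : ∀ p : Nat.Primes, (0 : ℝ) < ((p : ℕ) : ℝ)^2 := fun p => by
    have := p.2.pos
    positivity
  -- facts for a general finite set
  have f0 : ∀ (A : Finset (ℤ × ℤ)) (p : Nat.Primes),
      0 ≤ 1 - ((redF (p : ℕ) A).card : ℝ) / ((p : ℕ) : ℝ)^2 := fun A p => by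
    rw [sub_nonneg, div_le_one (hpos p)]
    exact redF_card_le_sq _ p.2 A
  have f1 : ∀ (A : Finset (ℤ × ℤ)) (p : Nat.Primes),
      1 - ((redF (p : ℕ) A).card : ℝ) / ((p : ℕ) : ℝ)^2 ≤ 1 := fun A p => by
    have : 0 ≤ ((redF (p : ℕ) A).card : ℝ) / ((p : ℕ) : ℝ)^2 := by positivity
    linarith
  have fu : ∀ (A : Finset (ℤ × ℤ)) (p : Nat.Primes),
      1 - (A.card : ℝ) / ((p : ℕ) : ℝ)^2 ≤
        1 - ((redF (p : ℕ) A).card : ℝ) / ((p : ℕ) : ℝ)^2 := fun A p => by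
    have : ((redF (p : ℕ) A).card : ℝ) ≤ A.card := by exact_mod_cast redF_card_le _ _
    gcongr
  set U : ℤ × ℤ → Finset (ℤ × ℤ) := fun x => (P.image fun y => x + y) ∪ Q with hU
  have hUc : ∀ x, ((U x).card : ℝ) ≤ C := fun x => by
    have h1 := Finset.card_union_le (P.image fun y => x + y) Q
    have h2 : (P.image fun y => x + y).card ≤ P.card := Finset.card_image_le
    have : (U x).card ≤ P.card + Q.card := by simp only [hU]; omega
    rw [hC]
    exact_mod_cast this
  set f : ℤ × ℤ → Nat.Primes → ℝ := fun x p =>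
    1 - ((redF (p : ℕ) (U x)).card : ℝ) / ((p : ℕ) : ℝ)^2 with hf
  have fxu : ∀ x p, 1 - u p ≤ f x p := fun x p => by
    refine le_trans ?_ (fu (U x) p)
    have := hUc x
    simp only [hu]
    gcongr
  set a : Nat.Primes → ℝ := fun p => 1 - ((redF (p : ℕ) P).card : ℝ) / ((p : ℕ) : ℝ)^2 with ha
  set b : Nat.Primes → ℝ := fun p => 1 - ((redF (p : ℕ) Q).card : ℝ) / ((p : ℕ) : ℝ)^2 with hb
  have abu : ∀ p, 1 - u p ≤ a p * b p := fun p => by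
    have h1 := fu P p
    have h2 := fu Q p
    have h3 := f1 P p
    have h4 := f1 Q p
    have h5 : u p = (P.card : ℝ) / ((p : ℕ) : ℝ)^2 + (Q.card : ℝ) / ((p : ℕ) : ℝ)^2 := by
      simp only [hu, hC, add_div]
    simp only [ha, hb]
    nlinarith
  have hab : (∏' p, a p) * (∏' p, b p) = ∏' p, a p * b p :=
    ((prod_mult a _ (summable_primes_sq P.card) (f1 P) (fu P)).tprod_mul
      (prod_mult b _ (summable_primes_sq Q.card) (f1 Q) (fu Q))).symm
  rw [hab]
  have hts : ∀ R : ℝ, (∑' x : ℤ × ℤ, if (x.1 : ℝ)^2 + (x.2 : ℝ)^2 < R^2 then ∏' p, f x p else 0) =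
      ∑ x ∈ discF R, ∏' p, f x p := by
    intro R
    rw [tsum_eq_sum (s := discF R)]
    · refine Finset.sum_congr rfl fun x hx => ?_
      rw [if_pos ((mem_discF R x).mp hx)]
    · intro x hx
      rw [if_neg (fun h => hx ((mem_discF R x).mpr h))]
  suffices H : Tendsto (fun R : ℝ => (∑ x ∈ discF R, ∏' p, f x p) / (Real.pi * R^2)) atTop
      (𝓝 (∏' p, a p * b p)) from
    H.congr fun R => congrArg (fun z => z / (Real.pi * R^2)) (hts R).symm
  rw [Metric.tendsto_atTop']
  intro ε hε
  obtain ⟨S, hS⟩ := summable_iff_vanishing_norm.mp hsu (ε / 5) (by positivity)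
  have hS' : ∀ T : Finset Nat.Primes, Disjoint T S → ∑ i ∈ T, u i ≤ ε / 5 := fun T hT =>
    (le_abs_self _).trans (hS T hT).le
  have t1 : ∀ x, |∏' p, f x p - ∏ p ∈ S, f x p| ≤ ε / 5 := fun x =>
    prod_tail (f x) u hsu S _ hS' (f0 (U x)) (f1 (U x)) (fxu x)
  have t2 : |∏' p, a p * b p - ∏ p ∈ S, a p * b p| ≤ ε / 5 :=
    prod_tail (fun p => a p * b p) u hsu S _ hS' (fun p => mul_nonneg (f0 P p) (f0 Q p))
      (fun p => mul_le_one₀ (f1 P p) (f0 Q p) (f1 Q p)) abu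
  obtain ⟨m, hm, G, -, hG, hmean⟩ := crt_mean (fun p y =>
    1 - ((((redF p P).image fun b => y + b) ∪ redF p Q).card : ℝ) / (p : ℝ)^2) S
  have hper := periodic_avg (fun x => ∏ p ∈ S, f x p)
    (fun x => Finset.prod_nonneg fun p _ => f0 (U x) p) m G (fun x => by
      rw [hG]
      refine Finset.prod_congr rfl fun p _ => ?_
      simp only [hf, hU]
      rw [redF_union])
  have hval : (∑ y, G y) / (m : ℝ)^2 = ∏ p ∈ S, a p * b p := by
    rw [hmean]
    refine Finset.prod_congr rfl fun p _ => ?_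
    haveI : NeZero (p : ℕ) := ⟨p.2.ne_zero⟩
    have := local_mean (redF (p : ℕ) P) (redF (p : ℕ) Q)
    simp only [Fintype.card_prod, ZMod.card, ← sq, Nat.cast_mul, Nat.cast_pow] at this
    exact this
  rw [hval] at hper
  have e1 := Metric.tendsto_nhds.mp hper (ε / 5) (by positivity)
  have e2 := discF_card_tendsto.eventually_lt_const (show (1 : ℝ) < 2 by norm_num)
  obtain ⟨N, hN⟩ := eventually_atTop.mp (e1.and (e2.and (eventually_gt_atTop 0)))
  refine ⟨N, fun R hR => ?_⟩
  obtain ⟨h1, h2, h3⟩ := hN R (le_of_lt hR)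
  rw [Real.dist_eq] at h1 ⊢
  have hpi := Real.pi_pos
  have hD : 0 < Real.pi * R^2 := by positivity
  have h4 : |(∑ x ∈ discF R, ∏' p, f x p) / (Real.pi * R^2) -
      (∑ x ∈ discF R, ∏ p ∈ S, f x p) / (Real.pi * R^2)| ≤ 2 * (ε / 5) := by
    rw [← sub_div, ← Finset.sum_sub_distrib, abs_div, abs_of_pos hD]
    have h5 : |∑ x ∈ discF R, (∏' p, f x p - ∏ p ∈ S, f x p)| ≤ (discF R).card * (ε / 5) := by
      refine (Finset.abs_sum_le_sum_abs _ _).trans ?_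
      rw [← nsmul_eq_mul]
      exact Finset.sum_le_card_nsmul _ _ _ fun x _ => t1 x
    calc _ ≤ (discF R).card * (ε / 5) / (Real.pi * R^2) := by gcongr
      _ = (discF R).card / (Real.pi * R^2) * (ε / 5) := by ring
      _ ≤ 2 * (ε / 5) := by gcongr
  rw [abs_lt] at h1 ⊢
  rw [abs_le] at h4 t2
  constructor <;> linarith
end

section
/- Let n, k ≥ 1 with nk ≥ 2, and let V = ℤⁿ \ ⋃_p p^k ℤⁿ be the set of k-free points of ℤⁿ (points whose coordinate gcd is not divisible by any nontrivial k-th power), the union running over all primes p. Then the natural density of V exists and equals 1/ζ(nk): lim_{R→∞} |V ∩ B_R(0)| / vol(B_R(0)) = 1/ζ(nk). -/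
open Filter Topology

/-- The set of `k`-free points of `ℤⁿ`: lattice points lying in no set `p^k ℤⁿ`. -/
def kfree (n k : ℕ) : Set (Fin n → ℤ) :=
  {x | ∀ p : ℕ, p.Prime → ¬ ∃ y : Fin n → ℤ, x = ((p : ℤ)^k) • y}

open MeasureTheory
open scoped Pointwise

/-- Nonzero lattice points in the open ball of radius `R`. -/
def nzBall (n : ℕ) (R : ℝ) : Set (Fin n → ℤ) := {x | x ≠ 0 ∧ ∑ i, ((x i : ℝ))^2 < R^2}

lemma ball_abs_lt {n : ℕ} {R : ℝ} (hR : 0 < R) {x : Fin n → ℤ}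
    (hx : ∑ i, ((x i : ℝ))^2 < R^2) (i : Fin n) : |(x i : ℝ)| < R := by
  have h1 : ((x i : ℝ))^2 ≤ ∑ i, ((x i : ℝ))^2 :=
    Finset.single_le_sum (f := fun i => ((x i : ℝ))^2) (fun _ _ => sq_nonneg _) (Finset.mem_univ i)
  exact abs_lt_of_sq_lt_sq (h1.trans_lt hx) hR.le

lemma ball_subset {n : ℕ} {R : ℝ} (hR : 0 < R) :
    {x : Fin n → ℤ | ∑ i, ((x i : ℝ))^2 < R^2} ⊆
      (Fintype.piFinset fun _ : Fin n => Finset.Icc (-⌊R⌋) ⌊R⌋ : Finset (Fin n → ℤ)) := by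
  intro x hx
  simp only [Finset.mem_coe, Fintype.mem_piFinset, Finset.mem_Icc]
  intro i
  have := abs_lt.1 (ball_abs_lt hR hx i)
  constructor
  · rw [neg_le]
    apply Int.le_floor.2
    push_cast
    linarith
  · exact Int.le_floor.2 this.2.le

lemma ball_finite {n : ℕ} {R : ℝ} (hR : 0 < R) :
    {x : Fin n → ℤ | ∑ i, ((x i : ℝ))^2 < R^2}.Finite :=
  (Finset.finite_toSet _).subset (ball_subset hR)

lemma nzBall_finite {n : ℕ} {R : ℝ} (hR : 0 < R) : (nzBall n R).Finite :=
  (ball_finite hR).subset fun _ h => h.2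

lemma nzBall_one_lt {n : ℕ} {R : ℝ} (hR : 0 < R) {x : Fin n → ℤ} (hx : x ∈ nzBall n R) :
    1 < R := by
  obtain ⟨h0, h⟩ := hx
  obtain ⟨i, hi⟩ := Function.ne_iff.1 h0
  have h1 := ball_abs_lt hR h i
  have h2 : (1 : ℝ) ≤ |(x i : ℝ)| := by exact_mod_cast Int.one_le_abs hi
  linarith

lemma nzBall_card_le {n : ℕ} {R : ℝ} (hR : 0 < R) :
    ((nzBall n R).ncard : ℝ) ≤ (3 * R) ^ n := by
  rcases Set.eq_empty_or_nonempty (nzBall n R) with h | ⟨x, hx⟩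
  · rw [h]; simp; positivity
  have h1 := nzBall_one_lt hR hx
  have h2 : (nzBall n R).ncard ≤ ((Fintype.piFinset fun _ : Fin n => Finset.Icc (-⌊R⌋) ⌊R⌋ :
      Finset (Fin n → ℤ)) : Set (Fin n → ℤ)).ncard :=
    Set.ncard_le_ncard (fun x hx => ball_subset hR hx.2) (Finset.finite_toSet _)
  rw [Set.ncard_coe_finset] at h2
  simp only [Fintype.card_piFinset, Int.card_Icc, Finset.prod_const, Finset.card_univ,
    Fintype.card_fin] at h2
  have h3 : ((nzBall n R).ncard : ℝ) ≤ (((⌊R⌋ + 1 - -⌊R⌋).toNat : ℕ) : ℝ) ^ n := by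
    exact_mod_cast h2
  refine h3.trans (pow_le_pow_left₀ (by positivity) ?_ n)
  have h4 : (0 : ℤ) ≤ ⌊R⌋ := Int.floor_nonneg.2 hR.le
  have h5 : (((⌊R⌋ + 1 - -⌊R⌋).toNat : ℕ) : ℝ) = ((⌊R⌋ + 1 - -⌊R⌋ : ℤ) : ℝ) := by
    rw [← Int.cast_natCast, Int.toNat_of_nonneg (by omega)]
  rw [h5]
  push_cast
  have := Int.floor_le R
  linarith

lemma exists_max_div (k g : ℕ) (hk : 1 ≤ k) (hg : g ≠ 0) :
    ∃ a : ℕ, a ≠ 0 ∧ ∀ m : ℕ, m ^ k ∣ g ↔ m ∣ a := by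
  have hb : ∀ m : ℕ, m ^ k ∣ g → m ≤ g := fun m hm =>
    (Nat.le_self_pow (by omega) m).trans (Nat.le_of_dvd (Nat.pos_of_ne_zero hg) hm)
  have h1 : (1 : ℕ) ^ k ∣ g := by simp
  have hP := Nat.findGreatest_spec (P := fun m => m ^ k ∣ g) (hb 1 h1) h1
  set a := Nat.findGreatest (fun m => m ^ k ∣ g) g with ha
  have ha0 : a ≠ 0 := by
    intro h
    rw [h, zero_pow (by omega)] at hP
    exact hg (Nat.eq_zero_of_zero_dvd hP)
  refine ⟨a, ha0, fun m => ⟨fun hm => ?_, fun hm => (pow_dvd_pow_of_dvd hm k).trans hP⟩⟩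
  have h2 : (Nat.lcm a m) ^ k ∣ g := by
    rw [← Nat.pow_lcm_pow]
    exact Nat.lcm_dvd hP hm
  have h3 : Nat.lcm a m ≤ a := Nat.le_findGreatest (hb _ h2) h2
  have h4 : Nat.lcm a m = a := le_antisymm h3 (Nat.le_of_dvd (Nat.pos_of_ne_zero (Nat.lcm_ne_zero ha0 (by
    rintro rfl
    rw [zero_pow (by omega)] at hm
    exact hg (Nat.eq_zero_of_zero_dvd hm)))) (Nat.dvd_lcm_left a m))
  rw [← h4]
  exact Nat.dvd_lcm_right a m

lemma exists_smul_iff {n : ℕ} (c : ℕ) (x : Fin n → ℤ) :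
    (∃ y : Fin n → ℤ, x = (c : ℤ) • y) ↔ c ∣ Finset.univ.gcd (fun i => (x i).natAbs) := by
  rw [Finset.dvd_gcd_iff]
  constructor
  · rintro ⟨y, rfl⟩ i -
    simp [Int.natAbs_mul]
  · intro h
    have h2 : ∀ i, ∃ z : ℤ, x i = c * z := fun i => Int.natCast_dvd.2 (h i (Finset.mem_univ i))
    choose y hy using h2
    exact ⟨y, funext fun i => by simp [hy i]⟩

open ArithmeticFunction in
open Classical in
lemma indicator_eq {n k : ℕ} (hk : 1 ≤ k) (x : Fin n → ℤ) (hx : x ≠ 0) (M : ℕ)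
    (hM : ∀ m : ℕ, (∃ y : Fin n → ℤ, x = ((m ^ k : ℕ) : ℤ) • y) → m < M) :
    (if x ∈ kfree n k then (1 : ℤ) else 0) =
      ∑ m ∈ Finset.range M,
        if (∃ y : Fin n → ℤ, x = ((m ^ k : ℕ) : ℤ) • y) then moebius m else 0 := by
  set g := Finset.univ.gcd (fun i => (x i).natAbs) with hg
  have hg0 : g ≠ 0 := by
    obtain ⟨i, hi⟩ := Function.ne_iff.1 hx
    rw [hg, Ne, Finset.gcd_eq_zero_iff]
    intro h
    exact hi (by simpa using h i (Finset.mem_univ i))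
  obtain ⟨a, ha0, ha⟩ := exists_max_div k g hk hg0
  have key : ∀ m : ℕ, (∃ y : Fin n → ℤ, x = ((m ^ k : ℕ) : ℤ) • y) ↔ m ∣ a := fun m => by
    rw [exists_smul_iff, ← hg, ha]
  simp only [key] at hM ⊢
  rw [← Finset.sum_filter]
  have h1 : (Finset.range M).filter (fun m => m ∣ a) = a.divisors := by
    ext m
    simp only [Finset.mem_filter, Finset.mem_range, Nat.mem_divisors]
    exact ⟨fun h => ⟨h.2, ha0⟩, fun h => ⟨hM m h.1, h.1⟩⟩
  rw [h1, ← coe_mul_zeta_apply, moebius_mul_coe_zeta, one_apply]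
  congr 1
  apply propext
  have h2 : x ∈ kfree n k ↔ ∀ p : ℕ, p.Prime → ¬ p ∣ a := by
    unfold kfree
    simp only [Set.mem_ofPred_eq, ← key]
    push_cast
    rfl
  rw [h2]
  exact Nat.eq_one_iff_not_exists_prime_dvd.symm

lemma card_multiples {n : ℕ} (c : ℕ) (hc : 0 < c) (R : ℝ) :
    {x : Fin n → ℤ | x ∈ nzBall n R ∧ ∃ y : Fin n → ℤ, x = (c : ℤ) • y}.ncard =
      (nzBall n (R / c)).ncard := by
  have hc' : (c : ℤ) ≠ 0 := by exact_mod_cast hc.ne'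
  have hcr : (0 : ℝ) < c := by exact_mod_cast hc
  have hin : Function.Injective (fun y : Fin n → ℤ => (c : ℤ) • y) :=
    smul_right_injective _ hc'
  rw [← Set.ncard_image_of_injective (nzBall n (R / c)) hin]
  congr 1
  have e : ∀ y : Fin n → ℤ, (c : ℤ) • y ∈ nzBall n R ↔ y ∈ nzBall n (R / c) := by
    intro y
    unfold nzBall
    simp only [Set.mem_ofPred_eq]
    apply and_congr
    · exact (smul_ne_zero_iff_right hc')
    · rw [div_pow, lt_div_iff₀ (by positivity), Finset.sum_mul]
      simp [mul_pow, mul_comm]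
  ext x
  constructor
  · rintro ⟨h, y, rfl⟩
    exact ⟨y, (e y).1 h, rfl⟩
  · rintro ⟨y, h, rfl⟩
    exact ⟨(e y).2 h, y, rfl⟩

open ArithmeticFunction in
lemma count_eq {n k : ℕ} (hk : 1 ≤ k) {R : ℝ} (hR : 0 < R) :
    (Nat.card {x : Fin n → ℤ // x ∈ kfree n k ∧ ∑ i, ((x i : ℝ))^2 < R^2} : ℝ) =
      ∑' m : ℕ, (moebius m : ℝ) * ((nzBall n (R / (m ^ k : ℕ))).ncard : ℝ) := by
  classical
  set M := ⌈R⌉₊ with hM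
  have hfin := nzBall_finite (n := n) hR
  have hlt : ∀ x ∈ nzBall n R, ∀ m : ℕ, (∃ y : Fin n → ℤ, x = ((m ^ k : ℕ) : ℤ) • y) → m < M := by
    rintro x hx m ⟨y, rfl⟩
    obtain ⟨i, hi⟩ := Function.ne_iff.1 hx.1
    have h1 := ball_abs_lt hR hx.2 i
    rw [hM, Nat.lt_ceil]
    refine lt_of_le_of_lt ?_ h1
    have hy : y i ≠ 0 := by
      intro h; apply hi; simp [h]
    have h3 : (1 : ℝ) ≤ |(y i : ℝ)| := by exact_mod_cast Int.one_le_abs hy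
    have h4 : (m : ℝ) ≤ (m : ℝ) ^ k := by exact_mod_cast Nat.le_self_pow (by omega) m
    simp only [Pi.smul_apply, smul_eq_mul, Int.cast_mul, Int.cast_natCast, Nat.cast_pow, abs_mul]
    rw [Int.cast_pow, Int.cast_natCast, abs_of_nonneg (by positivity : (0:ℝ) ≤ (m : ℝ) ^ k)]
    nlinarith [Nat.cast_nonneg (α := ℝ) m]
  rw [tsum_eq_sum (s := Finset.range M)]
  · have hz : ∀ x ∈ kfree n k, x ≠ 0 := by
      rintro x hx rfl
      exact hx 2 Nat.prime_two ⟨0, by simp⟩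
    have h1 : Nat.card {x : Fin n → ℤ // x ∈ kfree n k ∧ ∑ i, ((x i : ℝ))^2 < R^2} =
        (hfin.toFinset.filter (fun x => x ∈ kfree n k)).card := by
      rw [← Set.ncard_coe_finset]
      refine congrArg Set.ncard (a₁ := {x | x ∈ kfree n k ∧ ∑ i, ((x i : ℝ))^2 < R^2}) ?_
      ext x
      simp only [Set.mem_ofPred_eq, Finset.coe_filter, Set.Finite.mem_toFinset, nzBall]
      exact ⟨fun h => ⟨⟨hz x h.1, h.2⟩, h.1⟩, fun h => ⟨h.2, h.1.2⟩⟩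
    have h2 : ((hfin.toFinset.filter (fun x => x ∈ kfree n k)).card : ℤ) =
        ∑ m ∈ Finset.range M, moebius m * ((nzBall n (R / (m ^ k : ℕ))).ncard : ℤ) := by
      rw [Finset.card_filter]
      push_cast
      rw [Finset.sum_congr rfl (fun x hx => indicator_eq hk x ((hfin.mem_toFinset.1 hx).1) M
        (hlt x (hfin.mem_toFinset.1 hx))), Finset.sum_comm]
      refine Finset.sum_congr rfl fun m _ => ?_
      rcases Nat.eq_zero_or_pos m with rfl | hm
      · simp
      rw [← Finset.sum_filter, Finset.sum_const, nsmul_eq_mul, mul_comm]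
      have := card_multiples (n := n) (m ^ k) (by positivity) R
      push_cast at this ⊢
      rw [← this, ← Set.ncard_coe_finset]
      simp
    rw [h1]
    have := congrArg (Int.cast : ℤ → ℝ) h2
    push_cast at this ⊢
    exact this
  · intro m hm
    rcases Nat.eq_zero_or_pos m with rfl | hm0
    · simp
    rw [← card_multiples (m ^ k) (by positivity) R]
    have : {x : Fin n → ℤ | x ∈ nzBall n R ∧ ∃ y : Fin n → ℤ, x = ((m ^ k : ℕ) : ℤ) • y} = ∅ := by
      ext x
      simp only [Set.mem_ofPred_eq, Set.mem_empty_iff_false, iff_false]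
      rintro ⟨hx, hy⟩
      exact hm (Finset.mem_range.2 (hlt x hx m hy))
    rw [this]
    simp

open ArithmeticFunction in
lemma moebius_tsum {N : ℕ} (hN : 2 ≤ N) :
    ∑' m : ℕ, (moebius m : ℝ) / (m : ℝ) ^ N = 1 / ∑' m : ℕ, 1 / ((m : ℝ) + 1)^N := by
  have hs : 1 < (N : ℂ).re := by simp; omega
  have h := LSeries_one_mul_Lseries_moebius hs
  have e1 : LSeries 1 (N : ℂ) = ((∑' m : ℕ, 1 / ((m : ℝ) + 1)^N : ℝ) : ℂ) := by
    have hsum : Summable (fun m : ℕ => LSeries.term 1 (N : ℂ) m) :=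
      LSeriesSummable_one_iff.2 hs
    rw [LSeries, hsum.tsum_eq_zero_add]
    push_cast
    simp [LSeries.term_def]
  have e2 : LSeries (fun m => ((moebius m : ℤ) : ℂ)) (N : ℂ) =
      ((∑' m : ℕ, (moebius m : ℝ) / (m : ℝ) ^ N : ℝ) : ℂ) := by
    rw [LSeries]
    push_cast
    refine tsum_congr fun m => ?_
    rcases Nat.eq_zero_or_pos m with rfl | hm
    · simp
    · simp [LSeries.term_def, hm.ne']
  rw [e1, e2] at h
  have h' : (∑' m : ℕ, 1 / ((m : ℝ) + 1)^N) * (∑' m : ℕ, (moebius m : ℝ) / (m : ℝ) ^ N) = 1 := by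
    exact_mod_cast h
  exact eq_one_div_of_mul_eq_one_right h'

lemma ball_count (n : ℕ) :
    Tendsto (fun R : ℝ => ({x : Fin n → ℤ | ∑ i, ((x i : ℝ))^2 < R^2}.ncard : ℝ) / R ^ n) atTop
      (𝓝 (volume.real (Metric.ball (0 : EuclideanSpace ℝ (Fin n)) 1))) := by
  set s : Set (Fin n → ℝ) := (WithLp.toLp 2) ⁻¹' (Metric.ball (0 : EuclideanSpace ℝ (Fin n)) 1)
    with hs
  have hmem : ∀ x : Fin n → ℝ, x ∈ s ↔ ∑ i, (x i)^2 < 1 := by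
    intro x
    rw [hs, Set.mem_preimage, mem_ball_zero_iff, EuclideanSpace.norm_eq]
    rw [Real.sqrt_lt' one_pos]
    simp
  have hvol : volume.real s = volume.real (Metric.ball (0 : EuclideanSpace ℝ (Fin n)) 1) := by
    rw [measureReal_def, measureReal_def, hs,
      (PiLp.volume_preserving_toLp (Fin n)).measure_preimage Metric.isOpen_ball.nullMeasurableSet]
  have hopen : IsOpen s := Metric.isOpen_ball.preimage (PiLp.continuous_toLp 2 _)
  have hconv : Convex ℝ s :=
    (convex_ball (0 : EuclideanSpace ℝ (Fin n)) 1).linear_preimage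
      (WithLp.linearEquiv 2 ℝ (Fin n → ℝ)).symm.toLinearMap
  have h0 : (0 : Fin n → ℝ) ∈ s := by rw [hmem]; simp
  have hbd : Bornology.IsBounded s := by
    refine (Metric.isBounded_closedBall (x := (0 : Fin n → ℝ)) (r := 1)).subset fun x hx => ?_
    rw [mem_closedBall_zero_iff, pi_norm_le_iff_of_nonneg zero_le_one]
    intro i
    rw [hmem] at hx
    have h1 : (x i)^2 ≤ ∑ i, (x i)^2 :=
      Finset.single_le_sum (f := fun i => (x i)^2) (fun _ _ => sq_nonneg _) (Finset.mem_univ i)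
    have : |x i| < 1 := abs_lt_of_sq_lt_sq (by linarith) zero_le_one
    exact this.le
  have hmono : ∀ ⦃x y : ℝ⦄, 0 < x → x ≤ y → x • s ⊆ y • s := by
    intro x y hx hxy
    have hy : 0 < y := hx.trans_le hxy
    rintro _ ⟨z, hz, rfl⟩
    rw [Set.mem_smul_set_iff_inv_smul_mem₀ hy.ne']
    simp only [smul_smul]
    exact hconv.smul_mem_of_zero_mem h0 hz ⟨by positivity, by
      rw [inv_mul_le_iff₀ hy]; linarith⟩
  have main := tendsto_card_div_pow_atTop_volume' s hbd hopen.measurableSet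
    (hconv.addHaar_frontier volume) hmono
  rw [hvol] at main
  refine main.congr' ?_
  filter_upwards [eventually_gt_atTop 0] with R hR
  rw [Fintype.card_fin]
  congr 2
  have hin : Function.Injective (fun y : Fin n → ℤ => R⁻¹ • (fun i => (y i : ℝ))) := by
    intro y z h
    have := smul_right_injective (Fin n → ℝ) (inv_ne_zero hR.ne') h
    funext i
    exact_mod_cast congrFun this i
  rw [← Set.ncard_image_of_injective _ hin]
  refine congrArg Set.ncard ?_
  ext v
  rw [Set.mem_inter_iff]
  have hL : ∀ w : Fin n → ℝ, w ∈ (Submodule.span ℤ (Set.range (Pi.basisFun ℝ (Fin n)))) ↔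
      ∃ y : Fin n → ℤ, (fun i => (y i : ℝ)) = w := by
    intro w
    rw [Module.Basis.mem_span_iff_repr_mem]
    constructor
    · intro h
      choose y hy using h
      exact ⟨y, funext fun i => by simpa using hy i⟩
    · rintro ⟨y, rfl⟩ i
      exact ⟨y i, by simp⟩
  have e : ∀ y : Fin n → ℤ, R⁻¹ • (fun i => (y i : ℝ)) ∈ s ↔ ∑ i, ((y i : ℝ))^2 < R^2 := by
    intro y
    rw [hmem]
    simp only [Pi.smul_apply, smul_eq_mul, mul_pow, ← Finset.mul_sum]
    rw [inv_pow, inv_mul_lt_iff₀ (by positivity), mul_one]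
  constructor
  · rintro ⟨h1, w, hw, rfl⟩
    obtain ⟨y, rfl⟩ := (hL w).1 hw
    exact ⟨y, (e y).1 h1, rfl⟩
  · rintro ⟨y, h, rfl⟩
    exact ⟨(e y).2 h, _, (hL _).2 ⟨y, rfl⟩, rfl⟩

lemma nzBall_count {n : ℕ} (hn : 1 ≤ n) :
    Tendsto (fun R : ℝ => ((nzBall n R).ncard : ℝ) / R ^ n) atTop
      (𝓝 (volume.real (Metric.ball (0 : EuclideanSpace ℝ (Fin n)) 1))) := by
  have h1 : Tendsto (fun R : ℝ => 1 / R ^ n) atTop (𝓝 0) := by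
    simp only [one_div]
    exact (tendsto_pow_atTop (α := ℝ) (n := n) (by omega)).inv_tendsto_atTop
  have h2 := (ball_count n).sub h1
  rw [sub_zero] at h2
  refine h2.congr' ?_
  filter_upwards [eventually_gt_atTop 0] with R hR
  rw [← sub_div]
  congr 1
  have h3 : {x : Fin n → ℤ | ∑ i, ((x i : ℝ))^2 < R^2} = insert 0 (nzBall n R) := by
    ext x
    simp only [nzBall, Set.mem_insert_iff, Set.mem_ofPred_eq]
    by_cases hx : x = 0
    · subst hx; simp; positivity
    · simp [hx]
  rw [h3, Set.ncard_insert_of_notMem (by simp [nzBall]) (nzBall_finite hR)]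
  push_cast
  ring

open ArithmeticFunction in
theorem kfree_density (n k : ℕ) (hn : 1 ≤ n) (hk : 1 ≤ k) (hnk : 2 ≤ n * k) :
    Tendsto (fun R : ℝ =>
      (Nat.card {x : Fin n → ℤ // x ∈ kfree n k ∧ ∑ i, ((x i : ℝ))^2 < R^2} : ℝ) /
        (MeasureTheory.volume (Metric.ball (0 : EuclideanSpace ℝ (Fin n)) R)).toReal)
      atTop (𝓝 (1 / ∑' m : ℕ, 1 / ((m : ℝ) + 1)^(n * k))) := by
  set V := volume.real (Metric.ball (0 : EuclideanSpace ℝ (Fin n)) 1) with hV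
  have hVpos : 0 < V := by
    rw [hV, measureReal_def]
    exact ENNReal.toReal_pos (Metric.measure_ball_pos _ _ one_pos).ne' measure_ball_lt_top.ne
  have hvol : ∀ R : ℝ, 0 < R →
      (volume (Metric.ball (0 : EuclideanSpace ℝ (Fin n)) R)).toReal = R ^ n * V := by
    intro R hR
    rw [Measure.addHaar_ball_of_pos volume _ hR, ENNReal.toReal_mul,
      ENNReal.toReal_ofReal (by positivity), finrank_euclideanSpace_fin, hV, measureReal_def]
  have hlim : Tendsto (fun R : ℝ => ∑' m : ℕ,
      (moebius m : ℝ) * (((nzBall n (R / (m ^ k : ℕ))).ncard : ℝ) / R ^ n)) atTop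
      (𝓝 (∑' m : ℕ, (moebius m : ℝ) * (V / (m : ℝ) ^ (n * k)))) := by
    have hsum : Summable (fun m : ℕ => 3 ^ n * (1 / (m : ℝ) ^ (n * k))) :=
      (Real.summable_one_div_nat_pow.2 (by omega)).mul_left _
    refine tendsto_tsum_of_dominated_convergence hsum ?_ ?_
    · intro m
      rcases Nat.eq_zero_or_pos m with rfl | hm
      · simp
      refine Tendsto.const_mul _ ?_
      have hc : (0 : ℝ) < ((m ^ k : ℕ) : ℝ) := by positivity
      have h1 := ((nzBall_count hn).comp (tendsto_id.atTop_div_const hc)).div_const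
        ((((m ^ k : ℕ) : ℝ)) ^ n)
      have h3 : (((m ^ k : ℕ) : ℝ)) ^ n = (m : ℝ) ^ (n * k) := by
        push_cast
        rw [← pow_mul, mul_comm]
      rw [← hV, h3] at h1
      refine h1.congr fun R => ?_
      simp only [Function.comp, id]
      rw [← h3, div_pow, div_div, div_mul_cancel₀ _ (by positivity)]
    · filter_upwards [eventually_gt_atTop 0] with R hR m
      rcases Nat.eq_zero_or_pos m with rfl | hm
      · simp
      have hc : (0 : ℝ) < ((m ^ k : ℕ) : ℝ) := by positivity
      have h1 := nzBall_card_le (n := n) (div_pos hR hc)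
      have h3 : (((m ^ k : ℕ) : ℝ)) ^ n = (m : ℝ) ^ (n * k) := by
        push_cast
        rw [← pow_mul, mul_comm]
      have hmu : |(moebius m : ℝ)| ≤ 1 := by exact_mod_cast abs_moebius_le_one
      rw [norm_mul, Real.norm_eq_abs, Real.norm_eq_abs, abs_of_nonneg (by positivity :
        (0 : ℝ) ≤ ((nzBall n (R / (m ^ k : ℕ))).ncard : ℝ) / R ^ n)]
      refine (mul_le_of_le_one_left (by positivity) hmu).trans ?_
      rw [div_le_iff₀ (by positivity)]
      refine h1.trans (le_of_eq ?_)
      rw [← h3, mul_pow, div_pow]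
      ring
  have hL : ∑' m : ℕ, (moebius m : ℝ) * (V / (m : ℝ) ^ (n * k)) =
      V * (1 / ∑' m : ℕ, 1 / ((m : ℝ) + 1)^(n * k)) := by
    rw [← moebius_tsum hnk, ← tsum_mul_left]
    refine tsum_congr fun m => by ring
  rw [hL] at hlim
  have h2 := hlim.div_const V
  rw [mul_div_cancel_left₀ _ hVpos.ne'] at h2
  refine h2.congr' ?_
  filter_upwards [eventually_gt_atTop 0] with R hR
  rw [hvol R hR, count_eq hk hR, ← div_div, ← tsum_div_const (a := R ^ n)]
  congr 1
  exact tsum_congr fun m => by ring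
end

section
/- Let n, k ≥ 1 with nk ≥ 2 and let V = ℤⁿ \ ⋃_p p^k ℤⁿ be the set of k-free points of ℤⁿ. Any ρ-patch P of V occurs with positive frequency, given by ν(P) = dens({t ∈ ℤⁿ : (V − t) ∩ B_ρ(0) = P}) = Σ_{F ⊆ (ℤⁿ ∩ B_ρ(0)) \ P} (−1)^{|F|} ∏_p (1 − |(P ∪ F)_p| / p^{nk}), where for A ⊆ ℤⁿ, A_p denotes the image of A under the reduction map ℤⁿ → (ℤ/p^kℤ)ⁿ, the sum runs over all subsets F of (ℤⁿ ∩ B_ρ(0)) \ P, and the product over all primes p. -/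
open Filter Topology

/-- Reduction of a finite subset of `ℤⁿ` modulo `m`. -/
def redFk (n m : ℕ) (P : Finset (Fin n → ℤ)) : Finset (Fin n → ZMod m) :=
  P.image fun x i => ((x i : ZMod m))

namespace KF

open scoped Pointwise

/-- Lattice points in the open Euclidean ball of radius `R`. -/
def bset (n : ℕ) (R : ℝ) : Set (Fin n → ℤ) := {t | ∑ i, ((t i : ℝ))^2 < R^2}

lemma coord_lt {n : ℕ} {R : ℝ} (hR : 0 ≤ R) {t : Fin n → ℤ} (ht : t ∈ bset n R) (i : Fin n) :
    |(t i : ℝ)| < R := by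
  have h1 : ((t i : ℝ))^2 ≤ ∑ i, ((t i : ℝ))^2 :=
    Finset.single_le_sum (f := fun i => ((t i : ℝ))^2) (fun _ _ => sq_nonneg _) (Finset.mem_univ i)
  exact abs_lt_of_sq_lt_sq (lt_of_le_of_lt h1 ht) hR

lemma bset_sub {n : ℕ} {R : ℝ} (hR : 0 ≤ R) :
    bset n R ⊆ ↑(Fintype.piFinset (fun _ : Fin n => Finset.Icc (-⌊R⌋) ⌊R⌋)) := by
  intro t ht
  simp only [Finset.mem_coe, Fintype.mem_piFinset, Finset.mem_Icc]
  intro i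
  have := abs_lt.1 (coord_lt hR ht i)
  refine ⟨?_, Int.le_floor.2 this.2.le⟩
  rw [neg_le]
  apply Int.le_floor.2
  push_cast
  linarith

lemma bset_finite (n : ℕ) (R : ℝ) : (bset n R).Finite := by
  have : bset n R = bset n |R| := by simp [bset]
  rw [this]
  exact (Finset.finite_toSet _).subset (bset_sub (abs_nonneg R))

/-- Lattice points in the ball, as a finset. -/
noncomputable def bF (n : ℕ) (R : ℝ) : Finset (Fin n → ℤ) := (bset_finite n R).toFinset

lemma mem_bF {n : ℕ} {R : ℝ} {t : Fin n → ℤ} : t ∈ bF n R ↔ ∑ i, ((t i : ℝ))^2 < R^2 := by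
  simp [bF, bset]

/-- Counting function. -/
noncomputable def cnt {n : ℕ} (A : Set (Fin n → ℤ)) (R : ℝ) : ℝ :=
  ∑ t ∈ bF n R, A.indicator (fun _ => (1 : ℝ)) t

open Classical in
lemma cnt_eq_card {n : ℕ} (A : Set (Fin n → ℤ)) (R : ℝ) :
    cnt A R = ((bF n R).filter (· ∈ A)).card := by
  simp [cnt, Set.indicator_apply]

lemma cnt_eq_natCard {n : ℕ} (A : Set (Fin n → ℤ)) (R : ℝ) :
    cnt A R = Nat.card {t : Fin n → ℤ // t ∈ A ∧ ∑ i, ((t i : ℝ))^2 < R^2} := by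
  classical
  rw [cnt_eq_card, Nat.cast_inj]
  refine (Nat.subtype_card _ fun t => ?_).symm
  rw [Finset.mem_filter, mem_bF, and_comm]

lemma cnt_mono {n : ℕ} {A B : Set (Fin n → ℤ)} (h : A ⊆ B) (R : ℝ) : cnt A R ≤ cnt B R :=
  Finset.sum_le_sum fun _ _ => Set.indicator_le_indicator_of_subset h (fun _ => zero_le_one) _

lemma cnt_union_le {n : ℕ} (A B : Set (Fin n → ℤ)) (R : ℝ) :
    cnt (A ∪ B) R ≤ cnt A R + cnt B R := by
  rw [cnt, cnt, cnt, ← Finset.sum_add_distrib]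
  refine Finset.sum_le_sum fun t _ => ?_
  by_cases h1 : t ∈ A <;> by_cases h2 : t ∈ B <;> simp [h1, h2]

lemma cnt_biUnion_le {n : ℕ} {ι : Type*} (s : Finset ι) (A : ι → Set (Fin n → ℤ)) (R : ℝ) :
    cnt (⋃ i ∈ s, A i) R ≤ ∑ i ∈ s, cnt (A i) R := by
  classical
  induction s using Finset.induction_on with
  | empty => simp [cnt]
  | insert a s ha ih =>
    rw [Finset.set_biUnion_insert, Finset.sum_insert ha]
    exact (cnt_union_le _ _ _).trans (by gcongr)

/-- If `f` injects `A ∩ B_R` into the finset `T`, then `cnt A R ≤ |T|`. -/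
lemma cnt_le_card {n : ℕ} {A : Set (Fin n → ℤ)} {R : ℝ} {α : Type*} (T : Finset α)
    (f : (Fin n → ℤ) → α) (hf : ∀ t ∈ A, t ∈ bF n R → f t ∈ T)
    (hinj : ∀ t ∈ A, ∀ s ∈ A, f t = f s → t = s) : cnt A R ≤ T.card := by
  classical
  rw [cnt_eq_card, Nat.cast_le]
  apply Finset.card_le_card_of_injOn f
  · intro t ht
    simp at ht
    exact hf t ht.2 ht.1
  · intro t ht s hs
    simp at ht hs
    exact hinj t ht.2 s hs.2

lemma cnt_le_cnt {n : ℕ} {A B : Set (Fin n → ℤ)} {R R' : ℝ}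
    (f : (Fin n → ℤ) → (Fin n → ℤ)) (hf : ∀ t ∈ A, t ∈ bF n R → f t ∈ B ∧ f t ∈ bF n R')
    (hinj : ∀ t ∈ A, ∀ s ∈ A, f t = f s → t = s) : cnt A R ≤ cnt B R' := by
  classical
  rw [cnt_eq_card B]
  apply cnt_le_card _ f _ hinj
  intro t h1 h2
  simp [hf t h1 h2]

lemma cnt_nonzero_le {n : ℕ} {R : ℝ} (hR : 0 ≤ R) : cnt {t : Fin n → ℤ | t ≠ 0} R ≤ (3 * R)^n := by
  rcases lt_or_ge R 1 with h | h
  · have : cnt {t : Fin n → ℤ | t ≠ 0} R = 0 := by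
      apply Finset.sum_eq_zero
      intro t ht
      have : t = 0 := by
        ext i
        have := (coord_lt hR (mem_bF.1 ht) i).trans h
        have : |t i| < 1 := by exact_mod_cast this
        simpa using Int.abs_lt_one_iff.1 this
      simp [this]
    rw [this]; positivity
  · refine (cnt_le_card (Fintype.piFinset (fun _ : Fin n => Finset.Icc (-⌊R⌋) ⌊R⌋)) id ?_ ?_).trans ?_
    · intro t _ ht
      exact bset_sub hR (mem_bF.1 ht)
    · intro t _ s _ h; exact h
    · have h0 : 0 ≤ ⌊R⌋ := Int.floor_nonneg.2 hR
      rw [Fintype.card_piFinset]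
      simp only [Int.card_Icc, Finset.prod_const, Finset.card_univ, Fintype.card_fin]
      push_cast
      gcongr
      have h2 : (((⌊R⌋ + 1 - -⌊R⌋).toNat : ℤ) : ℝ) = 2 * (⌊R⌋ : ℝ) + 1 := by
        rw [Int.toNat_of_nonneg (by omega)]; push_cast; ring
      have h3 := Int.floor_le R
      have : (((⌊R⌋ + 1 - -⌊R⌋).toNat : ℕ) : ℝ) = 2 * (⌊R⌋ : ℝ) + 1 := by exact_mod_cast h2
      rw [this]; linarith

/-- Volume of the Euclidean unit ball. -/
noncomputable def vol (n : ℕ) : ℝ :=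
  (MeasureTheory.volume (Metric.ball (0 : EuclideanSpace ℝ (Fin n)) 1)).toReal

lemma vol_pos (n : ℕ) : 0 < vol n := by
  rw [vol]
  apply ENNReal.toReal_pos
  · exact (Metric.measure_ball_pos _ _ one_pos).ne'
  · exact MeasureTheory.measure_ball_lt_top.ne

lemma vol_ball (n : ℕ) {R : ℝ} (hR : 0 < R) :
    (MeasureTheory.volume (Metric.ball (0 : EuclideanSpace ℝ (Fin n)) R)).toReal =
      R ^ n * vol n := by
  rw [MeasureTheory.Measure.addHaar_ball_of_pos _ _ hR, ENNReal.toReal_mul, vol,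
    ENNReal.toReal_ofReal (by positivity)]
  simp

/-- `A` has density `d`. -/
def HasDens {n : ℕ} (A : Set (Fin n → ℤ)) (d : ℝ) : Prop :=
  Tendsto (fun R => cnt A R / R ^ n) atTop (𝓝 (d * vol n))

/-- unit ball in `Fin n → ℝ` -/
def ub (n : ℕ) : Set (Fin n → ℝ) := {x | ∑ i, (x i)^2 < 1}

lemma ub_eq (n : ℕ) : ub n = (WithLp.toLp 2) ⁻¹' (Metric.ball (0 : EuclideanSpace ℝ (Fin n)) 1) := by
  ext x
  simp only [ub, Set.mem_ofPred_eq, Set.mem_preimage, mem_ball_zero_iff, EuclideanSpace.norm_eq]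
  rw [Real.sqrt_lt' one_pos]
  simp

lemma ub_vol (n : ℕ) : MeasureTheory.volume.real (ub n) = vol n := by
  rw [ub_eq, vol, MeasureTheory.measureReal_def]
  rw [(PiLp.volume_preserving_toLp (Fin n)).measure_preimage
    measurableSet_ball.nullMeasurableSet]

lemma ub_open (n : ℕ) : IsOpen (ub n) :=
  isOpen_lt (by fun_prop) (by fun_prop)

lemma ub_convex (n : ℕ) : Convex ℝ (ub n) := by
  rw [ub_eq]
  exact (convex_ball _ _).linear_preimage (WithLp.linearEquiv 2 ℝ (Fin n → ℝ)).symm.toLinearMap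

lemma ub_bdd (n : ℕ) : Bornology.IsBounded (ub n) := by
  refine (Metric.isBounded_ball (x := (0 : Fin n → ℝ)) (r := 2)).subset ?_
  intro x hx
  rw [mem_ball_zero_iff]
  refine lt_of_le_of_lt ((pi_norm_le_iff_of_nonneg zero_le_one).2 fun i => ?_) one_lt_two
  have h1 : (x i)^2 ≤ ∑ i, (x i)^2 :=
    Finset.single_le_sum (f := fun i => (x i)^2) (fun _ _ => sq_nonneg _) (Finset.mem_univ i)
  have : (x i)^2 < 1 := lt_of_le_of_lt h1 hx
  exact ((sq_lt_one_iff_abs_lt_one _).1 this).le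

lemma hasDens_univ (n : ℕ) : HasDens (Set.univ : Set (Fin n → ℤ)) 1 := by
  have := tendsto_card_div_pow_atTop_volume' (ub n) (ub_bdd n) (ub_open n).measurableSet
    ((ub_convex n).addHaar_frontier _) (by
      intro x y hx hxy
      have hy := hx.trans_le hxy
      rintro _ ⟨z, hz, rfl⟩
      refine ⟨(x / y) • z, ?_, ?_⟩
      · simp only [ub, Set.mem_ofPred_eq, Pi.smul_apply, smul_eq_mul, mul_pow, ← Finset.mul_sum] at hz ⊢
        have h1 : (x/y)^2 ≤ 1 := pow_le_one₀ (by positivity) ((div_le_one hy).2 hxy)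
        have h2 : 0 ≤ ∑ i, (z i)^2 := Finset.sum_nonneg fun _ _ => sq_nonneg _
        nlinarith
      · simp only [smul_smul]; congr 1; field_simp)
  rw [ub_vol] at this
  rw [HasDens, one_mul]
  refine this.congr' ?_
  filter_upwards [eventually_gt_atTop 0] with R hR
  rw [Fintype.card_fin, cnt_eq_natCard]
  congr 2
  symm
  refine Nat.card_congr (Equiv.ofBijective (fun t => ⟨R⁻¹ • (fun i => (t.1 i : ℝ)), ?_, ?_⟩) ⟨?_, ?_⟩)
  · have := t.2.2
    simp only [ub, Set.mem_ofPred_eq, Pi.smul_apply, smul_eq_mul, mul_pow, ← Finset.mul_sum]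
    rw [inv_pow, inv_mul_lt_one₀ (by positivity)]
    exact this
  · refine ⟨_, ?_, rfl⟩
    rw [SetLike.mem_coe, Module.Basis.mem_span_iff_repr_mem]
    simp
  · intro s t h
    have h2 := smul_right_injective (Fin n → ℝ) (inv_ne_zero hR.ne') (Subtype.ext_iff.1 h)
    ext i
    exact_mod_cast congrFun h2 i
  · rintro ⟨x, hx1, y, hy, rfl⟩
    rw [SetLike.mem_coe, Module.Basis.mem_span_iff_repr_mem] at hy
    simp at hy
    choose t ht using hy
    obtain rfl : (fun i => (t i : ℝ)) = y := funext ht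
    refine ⟨⟨t, trivial, ?_⟩, rfl⟩
    simp only [ub, Set.mem_ofPred_eq, Pi.smul_apply, smul_eq_mul, mul_pow, ← Finset.mul_sum] at hx1
    rwa [inv_pow, inv_mul_lt_one₀ (by positivity)] at hx1

/-- Euclidean norm of a lattice point. -/
noncomputable def nm {n : ℕ} (t : Fin n → ℤ) : ℝ :=
  ‖(WithLp.toLp 2 (fun i => (t i : ℝ)) : EuclideanSpace ℝ (Fin n))‖

lemma nm_nonneg {n : ℕ} (t : Fin n → ℤ) : 0 ≤ nm t := norm_nonneg _

lemma mem_bF_nm {n : ℕ} {R : ℝ} (hR : 0 < R) {t : Fin n → ℤ} : t ∈ bF n R ↔ nm t < R := by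
  rw [mem_bF, nm, EuclideanSpace.norm_eq, Real.sqrt_lt' hR]
  simp

lemma nm_add {n : ℕ} (s t : Fin n → ℤ) : nm (s + t) ≤ nm s + nm t := by
  refine le_trans (le_of_eq ?_) (norm_add_le _ _)
  rw [nm, ← WithLp.toLp_add]
  congr 2
  ext i
  simp

lemma nm_smul {n : ℕ} (m : ℤ) (t : Fin n → ℤ) : nm (m • t) = |(m : ℝ)| * nm t := by
  rw [nm, nm, ← Real.norm_eq_abs, ← norm_smul, ← WithLp.toLp_smul]
  congr 2
  ext i
  simp

lemma nm_neg {n : ℕ} (t : Fin n → ℤ) : nm (-t) = nm t := by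
  have := nm_smul (-1) t
  simpa using this

lemma nm_sub {n : ℕ} (s t : Fin n → ℤ) : nm (s - t) ≤ nm s + nm t := by
  rw [sub_eq_add_neg, ← nm_neg t]; exact nm_add _ _

/-- The coset `a + Mℤⁿ`. -/
def coset {n : ℕ} (M : ℕ) (a : Fin n → ℤ) : Set (Fin n → ℤ) := {t | ∃ z : Fin n → ℤ, t = (M : ℤ) • z + a}

lemma tendsto_aux (n : ℕ) (M : ℕ) (hM : 0 < M) (c : ℝ) :
    Tendsto (fun R : ℝ => cnt (Set.univ : Set (Fin n → ℤ)) ((R + c) / M) / R ^ n) atTop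
      (𝓝 (1 / (M : ℝ) ^ n * vol n)) := by
  have hM' : (0 : ℝ) < M := by exact_mod_cast hM
  have h1 : Tendsto (fun R : ℝ => (R + c) / M) atTop atTop :=
    (tendsto_atTop_add_const_right _ _ tendsto_id).atTop_div_const hM'
  have h2 := (hasDens_univ n).comp h1
  have h3 : Tendsto (fun R : ℝ => (R + c) / M / R) atTop (𝓝 (1 / M)) := by
    have : Tendsto (fun R : ℝ => (1 + c * R⁻¹) / M) atTop (𝓝 ((1 + c * 0) / M)) :=
      ((tendsto_inv_atTop_zero.const_mul c).const_add 1).div_const _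
    rw [mul_zero, add_zero] at this
    refine this.congr' ?_
    filter_upwards [eventually_gt_atTop 0] with R hR
    field_simp
  have h4 := h2.mul (h3.pow n)
  rw [show (1 / (M : ℝ) ^ n * vol n) = 1 * vol n * (1 / (M : ℝ)) ^ n by rw [one_div_pow]; ring]
  refine h4.congr' ?_
  filter_upwards [eventually_gt_atTop 0, eventually_gt_atTop (-c)] with R hR hc
  have : (0 : ℝ) < R + c := by linarith
  simp only [Function.comp]
  rw [div_pow _ R, div_mul_div_comm, mul_comm (cnt _ _), mul_div_mul_left]
  positivity

lemma hasDens_coset {n : ℕ} (M : ℕ) (hM : 0 < M) (a : Fin n → ℤ) :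
    HasDens (coset M a) (1 / (M : ℝ) ^ n) := by
  have hM' : (0 : ℝ) < M := by exact_mod_cast hM
  have hMz : (M : ℤ) ≠ 0 := by exact_mod_cast hM.ne'
  refine tendsto_of_tendsto_of_tendsto_of_le_of_le' (tendsto_aux n M hM (-nm a))
    (tendsto_aux n M hM (nm a)) ?_ ?_
  · filter_upwards [eventually_gt_atTop 0, eventually_gt_atTop (nm a)] with R hR hc
    gcongr
    apply cnt_le_cnt (fun z => (M : ℤ) • z + a)
    · intro z _ hz
      refine ⟨⟨z, rfl⟩, ?_⟩
      rw [mem_bF_nm (div_pos (by linarith) hM'), lt_div_iff₀ hM'] at hz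
      rw [mem_bF_nm hR]
      have h1 := nm_add ((M : ℤ) • z) a
      rw [nm_smul] at h1
      rw [Int.cast_natCast, abs_of_pos hM'] at h1
      linarith
    · intro z _ w _ h
      exact smul_right_injective _ hMz (add_right_cancel h)
  · filter_upwards [eventually_gt_atTop 0] with R hR
    have := nm_nonneg a
    gcongr
    apply cnt_le_cnt (fun t i => (t i - a i) / (M : ℤ))
    · rintro _ ⟨z, rfl⟩ hz
      refine ⟨trivial, ?_⟩
      have h0 : (fun i => (((M : ℤ) • z + a) i - a i) / (M : ℤ)) = z := by
        ext i; simp; exact Int.mul_ediv_cancel_left _ hMz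
      rw [h0, mem_bF_nm (div_pos (by linarith) hM'), lt_div_iff₀ hM']
      rw [mem_bF_nm hR] at hz
      have h1 := nm_sub ((M : ℤ) • z + a) a
      rw [add_sub_cancel_right, nm_smul] at h1
      rw [Int.cast_natCast, abs_of_pos hM'] at h1
      linarith
    · rintro _ ⟨z, rfl⟩ _ ⟨w, rfl⟩ h
      have h0 : ∀ z : Fin n → ℤ, (fun i => (((M : ℤ) • z + a) i - a i) / (M : ℤ)) = z := by
        intro z; ext i; simp; exact Int.mul_ediv_cancel_left _ hMz
      simp only [h0] at h
      rw [h]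

lemma hasDens_biUnion {n : ℕ} {ι : Type*} (s : Finset ι) (A : ι → Set (Fin n → ℤ)) (d : ℝ)
    (hd : ∀ i ∈ s, HasDens (A i) d) (hdisj : ∀ i ∈ s, ∀ j ∈ s, ∀ t, t ∈ A i → t ∈ A j → i = j)  :
    HasDens (⋃ i ∈ s, A i) (s.card * d) := by
  have h := tendsto_finsetSum s hd
  rw [Finset.sum_const, nsmul_eq_mul, ← mul_assoc] at h
  refine h.congr fun R => ?_
  rw [← Finset.sum_div]
  congr 1
  simp only [cnt]
  rw [Finset.sum_comm]
  refine Finset.sum_congr rfl fun t _ => ?_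
  by_cases ht : t ∈ ⋃ i ∈ s, A i
  · rw [Set.indicator_of_mem ht]
    simp only [Set.mem_iUnion] at ht
    obtain ⟨i, hi, hti⟩ := ht
    rw [Finset.sum_eq_single_of_mem i hi, Set.indicator_of_mem hti]
    intro j hj hji
    rw [Set.indicator_of_notMem]
    intro htj
    exact hji (hdisj j hj i hi t htj hti)
  · rw [Set.indicator_of_notMem ht]
    apply Finset.sum_eq_zero
    intro i hi
    rw [Set.indicator_of_notMem]
    intro hti
    apply ht
    simp only [Set.mem_iUnion]
    exact ⟨i, hi, hti⟩

/-- Reduction of a point. -/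
def red {n : ℕ} (m : ℕ) (t : Fin n → ℤ) : Fin n → ZMod m := fun i => (t i : ZMod m)

lemma red_eq_iff {n m : ℕ} (s t : Fin n → ℤ) : red m s = red m t ↔ ∃ z : Fin n → ℤ, s = (m : ℤ) • z + t := by
  constructor
  · intro h
    have : ∀ i, ∃ z, s i = (m : ℤ) * z + t i := by
      intro i
      have := (ZMod.intCast_eq_intCast_iff_dvd_sub _ _ _).1 (congrFun h i).symm
      obtain ⟨z, hz⟩ := this
      exact ⟨z, by linarith⟩
    choose z hz using this
    exact ⟨z, funext fun i => by simp [hz i]⟩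
  · rintro ⟨z, rfl⟩
    ext i
    simp [red]

lemma red_surj {n m : ℕ} (g : Fin n → ZMod m) : ∃ t : Fin n → ℤ, red m t = g := by
  have : ∀ i, ∃ z : ℤ, (z : ZMod m) = g i := fun i => ZMod.intCast_surjective _
  choose t ht using this
  exact ⟨t, funext ht⟩

lemma coset_eq {n : ℕ} (M : ℕ) (a : Fin n → ℤ) : coset M a = {t | red M t = red M a} := by
  ext t
  exact (red_eq_iff t a).symm

/-- binary Chinese remainder theorem -/
lemma crt {n M q : ℕ} (h : Nat.Coprime M q) (a : Fin n → ℤ) (g : Fin n → ZMod q) :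
    ∃ b : Fin n → ℤ, ∀ t : Fin n → ℤ, (red M t = red M a ∧ red q t = g) ↔ red (M * q) t = red (M * q) b := by
  obtain ⟨c, rfl⟩ := red_surj g
  have hc : IsCoprime (M : ℤ) (q : ℤ) := Nat.isCoprime_iff_coprime.2 h
  obtain ⟨u, v, huv⟩ := hc
  refine ⟨(u * M) • c + (v * q) • a, fun t => ?_⟩
  have e1 : ∀ (m : ℕ) (x y : Fin n → ℤ), red m x = red m y ↔ ∀ i, (m : ℤ) ∣ y i - x i := by
    intro m x y
    rw [funext_iff]
    exact forall_congr' fun i => ZMod.intCast_eq_intCast_iff_dvd_sub _ _ _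
  simp only [e1, ← forall_and]
  refine forall_congr' fun i => ?_
  simp only [Pi.add_apply, Pi.smul_apply, smul_eq_mul]
  push_cast
  have k1 : u * M * c i + v * q * a i - t i = (a i - t i) + M * (u * (c i - a i)) := by
    linear_combination a i * huv
  have k2 : u * M * c i + v * q * a i - t i = (c i - t i) + q * (v * (a i - c i)) := by
    linear_combination c i * huv
  constructor
  · rintro ⟨h1, h2⟩
    apply IsCoprime.mul_dvd ⟨u, v, huv⟩
    · rw [k1]; exact dvd_add h1 (dvd_mul_right _ _)
    · rw [k2]; exact dvd_add h2 (dvd_mul_right _ _)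
  · intro h
    constructor
    · have := (dvd_mul_right (M : ℤ) q).trans h
      rw [k1] at this
      exact (dvd_add_left (dvd_mul_right _ _)).1 this
    · have := (dvd_mul_left (q : ℤ) M).trans h
      rw [k2] at this
      exact (dvd_add_left (dvd_mul_right _ _)).1 this

lemma hasDens_finite {n k : ℕ} (G : ∀ p : Nat.Primes, Finset (Fin n → ZMod ((p : ℕ) ^ k)))
    (S : Finset Nat.Primes) : ∀ (M : ℕ) (_ : 0 < M) (_ : ∀ p ∈ S, Nat.Coprime M (p : ℕ)) (a : Fin n → ℤ),
    HasDens {t | red M t = red M a ∧ ∀ p ∈ S, red ((p : ℕ) ^ k) t ∈ G p}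
      (1 / (M : ℝ) ^ n * ∏ p ∈ S, ((G p).card / ((p : ℕ) : ℝ) ^ (n * k))) := by
  classical
  induction S using Finset.induction_on with
  | empty =>
    intro M hM _ a
    have := hasDens_coset M hM a
    rw [coset_eq] at this
    simpa using this
  | insert p S hp ih =>
    intro M hM hcop a
    have hpp : 0 < (p : ℕ) := p.2.pos
    have hMp : Nat.Coprime M ((p : ℕ) ^ k) := Nat.Coprime.pow_right _ (hcop p (Finset.mem_insert_self _ _))
    choose b hb using fun g : Fin n → ZMod ((p : ℕ) ^ k) => crt hMp a g
    have key := hasDens_biUnion (G p) (fun g => {t | red (M * (p : ℕ) ^ k) t = red (M * (p : ℕ) ^ k) (b g) ∧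
      ∀ q ∈ S, red ((q : ℕ) ^ k) t ∈ G q}) _ (fun g _ => ih (M * (p : ℕ) ^ k) (by positivity) (by
        intro q hq
        refine Nat.Coprime.mul_left (hcop q (Finset.mem_insert_of_mem hq)) (Nat.Coprime.pow_left _ ?_)
        rw [Nat.coprime_primes p.2 q.2]
        rintro h
        exact hp ((Subtype.ext h : p = q) ▸ hq)) (b g)) (by
        intro g _ g' _ t h1 h2
        exact ((hb g t).2 h1.1).2.symm.trans ((hb g' t).2 h2.1).2)
    convert key using 1
    · ext t
      simp only [Set.mem_ofPred_eq, Finset.mem_insert, forall_eq_or_imp, Set.mem_iUnion, ← hb]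
      constructor
      · rintro ⟨h1, h2, h3⟩
        exact ⟨_, h2, ⟨h1, rfl⟩, h3⟩
      · rintro ⟨g, h2, ⟨h1, rfl⟩, h3⟩
        exact ⟨h1, h2, h3⟩
    · rw [Finset.prod_insert hp]
      have : ((p : ℕ) : ℝ) ≠ 0 := by exact_mod_cast hpp.ne'
      push_cast
      rw [mul_pow, ← pow_mul, mul_comm k n]
      field_simp

lemma cnt_mono' {n : ℕ} {A B : Set (Fin n → ℤ)} {R : ℝ} (h : ∀ t ∈ A, t ∈ bF n R → t ∈ B) :
    cnt A R ≤ cnt B R :=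
  cnt_le_cnt id (fun t h1 h2 => ⟨h t h1 h2, h2⟩) (fun _ _ _ _ h => h)

lemma one_le_nm {n : ℕ} {y : Fin n → ℤ} (hy : y ≠ 0) : 1 ≤ nm y := by
  by_contra! h
  apply hy
  rw [← mem_bF_nm one_pos, mem_bF] at h
  ext i
  have := coord_lt zero_le_one h i
  have : |y i| < 1 := by exact_mod_cast this
  simpa using Int.abs_lt_one_iff.1 this

/-- Points `t` with `q + t ∈ p^k ℤⁿ` for some `p > N`, `q ∈ Q`. -/
def tail {n : ℕ} (k : ℕ) (Q : Finset (Fin n → ℤ)) (N : ℕ) : Set (Fin n → ℤ) :=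
  {t | ∃ p : ℕ, N < p ∧ ∃ q ∈ Q, ∃ y : Fin n → ℤ, q + t = ((p : ℤ) ^ k) • y}

lemma cnt_U {n k : ℕ} (hnk : 2 ≤ n * k) (p : ℕ) (hp : 0 < p) (q : Fin n → ℤ) (c : ℝ)
    (hc : nm q ≤ c) (R : ℝ) (hR : 0 < R) :
    cnt {t : Fin n → ℤ | q + t ≠ 0 ∧ ∃ y : Fin n → ℤ, q + t = ((p : ℤ) ^ k) • y} R ≤
      3 ^ n * (R + c) ^ n * ((p : ℝ) ^ 2)⁻¹ := by
  have hc0 := (nm_nonneg q).trans hc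
  have hp' : (0 : ℝ) < (p : ℝ) ^ k := by positivity
  have hpz : ((p : ℤ) ^ k) ≠ 0 := by positivity
  have hpr : (1 : ℝ) ≤ p := by exact_mod_cast hp
  have h0 : ∀ y : Fin n → ℤ, (fun i => (((p : ℤ) ^ k) • y) i / ((p : ℤ) ^ k)) = y := by
    intro z; ext i; simp only [Pi.smul_apply, smul_eq_mul]; exact Int.mul_ediv_cancel_left _ hpz
  calc _ ≤ cnt {t : Fin n → ℤ | t ≠ 0} ((R + c) / (p : ℝ) ^ k) := by
        apply cnt_le_cnt (fun t i => (q + t) i / ((p : ℤ) ^ k))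
        · rintro t ⟨h1, y, hy⟩ ht
          rw [hy, h0]
          refine ⟨?_, ?_⟩
          · rintro rfl
            exact h1 (by simpa using hy)
          · rw [mem_bF_nm (by positivity), lt_div_iff₀ hp']
            rw [mem_bF_nm hR] at ht
            have h2 := nm_add q t
            rw [hy, nm_smul] at h2
            push_cast at h2
            rw [abs_of_pos hp'] at h2
            linarith
        · rintro t ⟨h1, y, hy⟩ s ⟨h1, z, hz⟩ h
          simp only [hy, hz, h0] at h
          rw [h, ← hz] at hy
          exact add_left_cancel hy
    _ ≤ (3 * ((R + c) / (p : ℝ) ^ k)) ^ n := cnt_nonzero_le (by positivity)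
    _ = 3 ^ n * (R + c) ^ n * ((p : ℝ) ^ (n * k))⁻¹ := by
        rw [mul_pow, div_pow, ← pow_mul, mul_comm k n]; ring
    _ ≤ _ := by gcongr

lemma cnt_tail_le {n k : ℕ} (hk : 1 ≤ k) (hnk : 2 ≤ n * k) (Q : Finset (Fin n → ℤ)) (N : ℕ)
    (c : ℝ) (hc0 : 0 ≤ c) (hc : ∀ q ∈ Q, nm q ≤ c) (R : ℝ) (hR : 0 < R) :
    cnt (tail k Q N) R ≤ Q.card + Q.card * (3 ^ n * (R + c) ^ n) * (2 / (N + 1)) := by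
  set K := ⌈R + c⌉₊ + 1
  calc cnt (tail k Q N) R ≤ cnt ((⋃ q ∈ Q, {-q}) ∪ ⋃ p ∈ Finset.Ioo N K, ⋃ q ∈ Q,
        {t : Fin n → ℤ | q + t ≠ 0 ∧ ∃ y : Fin n → ℤ, q + t = ((p : ℤ) ^ k) • y}) R := by
        apply cnt_mono'
        rintro t ⟨p, hNp, q, hq, y, hy⟩ ht
        by_cases h : q + t = 0
        · left
          simp only [Set.mem_iUnion, Set.mem_singleton_iff]
          exact ⟨q, hq, (neg_eq_of_add_eq_zero_right h).symm⟩
        · right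
          simp only [Set.mem_iUnion]
          refine ⟨p, ?_, q, hq, h, y, hy⟩
          rw [Finset.mem_Ioo]
          refine ⟨hNp, ?_⟩
          have hy0 : y ≠ 0 := by
            rintro rfl; exact h (by simpa using hy)
          have h1 := one_le_nm hy0
          have h2 := nm_add q t
          have h3 := hc q hq
          rw [mem_bF_nm hR] at ht
          rw [hy, nm_smul] at h2
          push_cast at h2
          rw [abs_of_nonneg (by positivity)] at h2
          have h4 : (p : ℝ) ≤ (p : ℝ) ^ k := by
            exact_mod_cast Nat.le_self_pow (by omega) p
          have h5 : (p : ℝ) < R + c := by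
            have : (p : ℝ) ^ k * 1 ≤ (p : ℝ) ^ k * nm y := by gcongr
            linarith
          have h6 : (p : ℝ) < ⌈R + c⌉₊ := h5.trans_le (Nat.le_ceil _)
          have : p < ⌈R + c⌉₊ := by exact_mod_cast h6
          omega
    _ ≤ ∑ q ∈ Q, cnt {-q} R + ∑ p ∈ Finset.Ioo N K, ∑ q ∈ Q,
        cnt {t : Fin n → ℤ | q + t ≠ 0 ∧ ∃ y : Fin n → ℤ, q + t = ((p : ℤ) ^ k) • y} R := by
        refine (cnt_union_le _ _ _).trans (add_le_add (cnt_biUnion_le _ _ _) ?_)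
        exact (cnt_biUnion_le _ _ _).trans (Finset.sum_le_sum fun p _ => cnt_biUnion_le _ _ _)
    _ ≤ ∑ q ∈ Q, 1 + ∑ p ∈ Finset.Ioo N K, ∑ q ∈ Q, 3 ^ n * (R + c) ^ n * ((p : ℝ) ^ 2)⁻¹ := by
        refine add_le_add (Finset.sum_le_sum fun q _ => ?_)
          (Finset.sum_le_sum fun p hp => Finset.sum_le_sum fun q hq => ?_)
        · have := cnt_le_card (A := {-q}) (R := R) ({0} : Finset ℕ) (fun _ => 0) (by simp) (by simp)
          simpa using this
        · have := (Finset.mem_Ioo.1 hp).1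
          exact cnt_U hnk p (by omega) q c (hc q hq) R hR
    _ = Q.card + Q.card * (3 ^ n * (R + c) ^ n) * ∑ p ∈ Finset.Ioo N K, ((p : ℝ) ^ 2)⁻¹ := by
        simp only [Finset.sum_const, nsmul_eq_mul, mul_one, Finset.mul_sum, mul_assoc]
    _ ≤ _ := by
        have := sum_Ioo_inv_sq_le (α := ℝ) N K
        gcongr

lemma tendsto_of_approx (f : ℝ → ℝ) (g : ℕ → ℝ → ℝ) (a : ℕ → ℝ) (α : ℝ) (b : ℕ → ℝ) (h : ℝ → ℝ)
    (hg : ∀ N, Tendsto (g N) atTop (𝓝 (a N))) (ha : Tendsto a atTop (𝓝 α))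
    (hb : Tendsto b atTop (𝓝 0)) (hh : Tendsto h atTop (𝓝 0))
    (H : ∀ᶠ N in atTop, ∀ᶠ R in atTop, |f R - g N R| ≤ b N + h R) : Tendsto f atTop (𝓝 α) := by
  rw [Metric.tendsto_nhds]
  intro ε hε
  have e1 := Metric.tendsto_nhds.1 ha (ε / 4) (by positivity)
  have e2 := Metric.tendsto_nhds.1 hb (ε / 4) (by positivity)
  obtain ⟨N, h1, h2, h3⟩ := (e1.and (e2.and H)).exists
  filter_upwards [h3, Metric.tendsto_nhds.1 hh (ε / 4) (by positivity),
    Metric.tendsto_nhds.1 (hg N) (ε / 4) (by positivity)] with R r1 r2 r3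
  rw [Real.dist_eq] at *
  rw [abs_lt] at *
  rw [abs_le] at r1
  constructor <;> linarith [r1.1, r1.2, r2.1, r2.2, r3.1, r3.2, h1.1, h1.2, h2.1, h2.2]

/-- primes up to `N` -/
def primesLE (N : ℕ) : Finset Nat.Primes := Finset.subtype Nat.Prime (Finset.range (N + 1))

lemma mem_primesLE {N : ℕ} {p : Nat.Primes} : p ∈ primesLE N ↔ (p : ℕ) ≤ N := by
  have : p ∈ primesLE N ↔ (p : ℕ) ∈ Finset.range (N + 1) := Finset.mem_subtype
  rw [this, Finset.mem_range]; omega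

lemma primesLE_tendsto : Tendsto primesLE atTop atTop := by
  apply tendsto_atTop_finset_of_monotone
  · intro a b hab p hp
    rw [mem_primesLE] at *
    omega
  · intro p
    exact ⟨p, mem_primesLE.2 le_rfl⟩

lemma hasDens_main {n k : ℕ} (hn : 1 ≤ n) (hk : 1 ≤ k) (hnk : 2 ≤ n * k)
    (G : ∀ p : Nat.Primes, Finset (Fin n → ZMod ((p : ℕ) ^ k))) (Q : Finset (Fin n → ℤ)) (N0 : ℕ)
    (hG : ∀ p : Nat.Primes, N0 < (p : ℕ) → ∀ t, red ((p : ℕ) ^ k) t ∉ G p →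
      ∃ q ∈ Q, ∃ y : Fin n → ℤ, q + t = (((p : ℕ) : ℤ) ^ k) • y) (d : ℝ)
    (hd : HasProd (fun p : Nat.Primes => ((G p).card : ℝ) / ((p : ℕ) : ℝ) ^ (n * k)) d) :
    HasDens {t | ∀ p : Nat.Primes, red ((p : ℕ) ^ k) t ∈ G p} d := by
  set A := {t | ∀ p : Nat.Primes, red ((p : ℕ) ^ k) t ∈ G p}
  set AN : ℕ → Set (Fin n → ℤ) := fun N => {t | ∀ p ∈ primesLE N, red ((p : ℕ) ^ k) t ∈ G p}
  have hc : ∃ c : ℝ, 0 ≤ c ∧ ∀ q ∈ Q, nm q ≤ c :=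
    ⟨∑ q ∈ Q, nm q, Finset.sum_nonneg fun _ _ => nm_nonneg _,
      fun q hq => Finset.single_le_sum (f := nm) (fun _ _ => nm_nonneg _) hq⟩
  obtain ⟨c, hc0, hc⟩ := hc
  refine tendsto_of_approx _ (fun N R => cnt (AN N) R / R ^ n)
    (fun N => (∏ p ∈ primesLE N, ((G p).card : ℝ) / ((p : ℕ) : ℝ) ^ (n * k)) * vol n) _
    (fun N => Q.card * (3 ^ n * 2 ^ n) * (2 / (N + 1))) (fun R => Q.card / R ^ n) ?_ ?_ ?_ ?_ ?_
  · intro N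
    have := hasDens_finite G (primesLE N) 1 one_pos (by simp) 0
    have e : {t : Fin n → ℤ | red 1 t = red 1 0 ∧ ∀ p ∈ primesLE N, red ((p : ℕ) ^ k) t ∈ G p} = AN N := by
      ext t
      simp only [AN, Set.mem_ofPred_eq, and_iff_right_iff_imp]
      intro _
      exact Subsingleton.elim _ _
    rw [e] at this
    simpa [HasDens] using this
  · exact (hd.comp primesLE_tendsto).mul_const _
  · have : Tendsto (fun N : ℕ => (1 : ℝ) / ((N : ℝ) + 1)) atTop (𝓝 0) := tendsto_one_div_add_atTop_nhds_zero_nat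
    have := this.const_mul ((Q.card : ℝ) * (3 ^ n * 2 ^ n) * 2)
    rw [mul_zero] at this
    refine this.congr fun N => by ring
  · exact Tendsto.div_atTop tendsto_const_nhds (tendsto_pow_atTop (by omega))
  · filter_upwards [eventually_ge_atTop N0] with N hN
    filter_upwards [eventually_gt_atTop 0, eventually_ge_atTop c] with R hR hRc
    have h1 : cnt A R ≤ cnt (AN N) R := cnt_mono (show A ⊆ AN N from fun t ht p _ => ht p) R
    have h2 : cnt (AN N) R ≤ cnt A R + cnt (tail k Q N) R := by
      refine (cnt_mono ?_ R).trans (cnt_union_le _ _ R)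
      intro t ht
      by_cases htA : t ∈ A
      · exact Or.inl htA
      · right
        simp only [A, Set.mem_ofPred_eq, not_forall] at htA
        obtain ⟨p, hp⟩ := htA
        have hNp : N < (p : ℕ) := by
          by_contra! hle
          exact hp (ht p (mem_primesLE.2 hle))
        exact ⟨p, hNp, hG p (by omega) t hp⟩
    have h3 := cnt_tail_le hk hnk Q N c hc0 hc R hR
    have hRn : 0 < R ^ n := by positivity
    rw [← sub_div, abs_div, abs_of_pos hRn, div_le_iff₀ hRn, add_mul, div_mul_cancel₀ _ hRn.ne',
      abs_of_nonpos (by linarith)]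
    have h4 : (Q.card : ℝ) * (3 ^ n * (R + c) ^ n) * (2 / (N + 1)) ≤
        Q.card * (3 ^ n * (2 * R) ^ n) * (2 / (N + 1)) := by
      gcongr; linarith
    rw [mul_pow] at h4
    have h5 : (Q.card : ℝ) * (3 ^ n * (2 ^ n * R ^ n)) * (2 / (N + 1)) =
       Q.card * (3 ^ n * 2 ^ n) * (2 / (N + 1)) * R ^ n := by ring
    linarith

instance primePowNeZero (p : Nat.Primes) (k : ℕ) : NeZero ((p : ℕ) ^ k) :=
  ⟨pow_ne_zero _ p.2.ne_zero⟩

/-- Admissible residues: those avoiding `-Q` modulo `p^k`. -/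
noncomputable def Gc {n : ℕ} (k : ℕ) (Q : Finset (Fin n → ℤ)) (p : Nat.Primes) :
    Finset (Fin n → ZMod ((p : ℕ) ^ k)) :=
  ((redFk n ((p : ℕ) ^ k) Q).image (fun g => -g))ᶜ

lemma mem_Gc {n k : ℕ} (Q : Finset (Fin n → ℤ)) (p : Nat.Primes) (t : Fin n → ℤ) :
    red ((p : ℕ) ^ k) t ∈ Gc k Q p ↔
      ∀ q ∈ Q, ¬ ∃ y : Fin n → ℤ, q + t = (((p : ℕ) : ℤ) ^ k) • y := by
  rw [Gc, Finset.mem_compl, Finset.mem_image, not_exists]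
  constructor
  · rintro h q hq ⟨y, hy⟩
    apply h (red _ q)
    refine ⟨Finset.mem_image_of_mem _ hq, ?_⟩
    ext i
    have := congrArg (fun z : ℤ => (z : ZMod ((p : ℕ) ^ k))) (congrFun hy i)
    simp only [Pi.add_apply, Pi.smul_apply, smul_eq_mul] at this
    push_cast at this
    have h0 : (((p : ℕ) : ZMod ((p : ℕ) ^ k))) ^ k = 0 := by
      have := ZMod.natCast_self ((p : ℕ) ^ k)
      push_cast at this
      exact this
    rw [h0, zero_mul] at this
    simp only [red, Pi.neg_apply]
    exact neg_eq_of_add_eq_zero_right this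
  · rintro h g ⟨hg, hgt⟩
    obtain ⟨q, hq, rfl⟩ := Finset.mem_image.1 hg
    apply h q hq
    have : red ((p : ℕ) ^ k) (q + t) = red ((p : ℕ) ^ k) 0 := by
      ext i
      have := congrFun hgt i
      simp only [red, Pi.neg_apply] at this
      simp [red, ← this]
    obtain ⟨z, hz⟩ := (red_eq_iff _ _).1 this
    refine ⟨z, ?_⟩
    rw [hz]
    push_cast
    simp

lemma card_Gc {n k : ℕ} (Q : Finset (Fin n → ℤ)) (p : Nat.Primes) :
    ((Gc k Q p).card : ℝ) / ((p : ℕ) : ℝ) ^ (n * k) =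
      1 - ((redFk n ((p : ℕ) ^ k) Q).card : ℝ) / ((p : ℕ) : ℝ) ^ (n * k) := by
  have hp : ((p : ℕ) : ℝ) ≠ 0 := by exact_mod_cast p.2.ne_zero
  have h1 : (Gc k Q p).card + (redFk n ((p : ℕ) ^ k) Q).card = (p : ℕ) ^ (n * k) := by
    have := Finset.card_compl_add_card ((redFk n ((p : ℕ) ^ k) Q).image (fun g => -g))
    rw [Finset.card_image_of_injective _ neg_injective] at this
    rw [Gc, this]
    simp [ZMod.card, ← pow_mul, mul_comm]
  have h2 : ((Gc k Q p).card : ℝ) + (redFk n ((p : ℕ) ^ k) Q).card = ((p : ℕ) : ℝ) ^ (n * k) := by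
    exact_mod_cast h1
  rw [eq_sub_iff_add_eq, ← add_div, h2, div_self]
  exact pow_ne_zero _ hp

lemma summable_red {n k : ℕ} (hnk : 2 ≤ n * k) (Q : Finset (Fin n → ℤ)) :
    Summable (fun p : Nat.Primes =>
      ((redFk n ((p : ℕ) ^ k) Q).card : ℝ) / ((p : ℕ) : ℝ) ^ (n * k)) := by
  have h1 : Summable (fun m : ℕ => (Q.card : ℝ) * ((m : ℝ) ^ 2)⁻¹) :=
    (Real.summable_nat_pow_inv.2 (by norm_num)).mul_left _
  have h2 : Summable (fun p : Nat.Primes => (Q.card : ℝ) * (((p : ℕ) : ℝ) ^ 2)⁻¹) :=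
    h1.comp_injective Subtype.val_injective
  refine Summable.of_nonneg_of_le (fun p => by positivity) (fun p => ?_) h2
  have hp : (1 : ℝ) ≤ ((p : ℕ) : ℝ) := by exact_mod_cast p.2.one_lt.le
  rw [div_eq_mul_inv]
  gcongr
  exact Finset.card_image_le

lemma hasProd_aux {f : Nat.Primes → ℝ} (hf : Summable (fun p => 1 - f p)) : HasProd f (∏' p, f p) := by
  have : Multipliable (fun p => 1 + (-(1 - f p))) :=
    Real.multipliable_one_add_of_summable hf.neg
  simp only [neg_sub, add_sub_cancel] at this
  exact this.hasProd

lemma tprod_pos_aux {f : Nat.Primes → ℝ} (hf : Summable (fun p => 1 - f p)) (h0 : ∀ p, 0 < f p) :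
    0 < ∏' p, f p := by
  have h1 : ∏' p, (1 + (-(1 - f p))) ≠ 0 := by
    apply tprod_one_add_ne_zero_of_summable
    · intro p
      simpa using (h0 p).ne'
    · exact hf.neg.norm
  simp only [neg_sub, add_sub_cancel] at h1
  refine lt_of_le_of_ne ?_ h1.symm
  refine ge_of_tendsto' (hasProd_aux hf) fun S => Finset.prod_nonneg fun p _ => (h0 p).le

lemma kfree_iff {n k : ℕ} (x : Fin n → ℤ) :
    x ∈ kfree n k ↔ ∀ p : Nat.Primes, ¬ ∃ y : Fin n → ℤ, x = (((p : ℕ) : ℤ) ^ k) • y :=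
  ⟨fun h p => h p p.2, fun h p hp => h ⟨p, hp⟩⟩

lemma hasDens_Q {n k : ℕ} (hn : 1 ≤ n) (hk : 1 ≤ k) (hnk : 2 ≤ n * k) (Q : Finset (Fin n → ℤ)) :
    HasDens {t | ∀ q ∈ Q, q + t ∈ kfree n k} (∏' p : Nat.Primes,
      (1 - ((redFk n ((p : ℕ) ^ k) Q).card : ℝ) / ((p : ℕ) : ℝ) ^ (n * k))) := by
  have := hasDens_main hn hk hnk (Gc k Q) Q 0 (by
    intro p _ t ht
    rw [mem_Gc] at ht
    push Not at ht
    exact ht) _ (by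
    simp only [card_Gc]
    apply hasProd_aux
    simpa using summable_red hnk Q)
  convert this using 1
  ext t
  simp only [Set.mem_ofPred_eq, mem_Gc, kfree_iff]
  exact ⟨fun h p q hq => h q hq p, fun h q hq p => h p q hq⟩

/-- Occurrences of the pattern `P` within the window `D`. -/
def occ {n : ℕ} (V : Set (Fin n → ℤ)) (P D : Finset (Fin n → ℤ)) : Set (Fin n → ℤ) :=
  {t | (∀ q ∈ P, q + t ∈ V) ∧ ∀ y ∈ D \ P, y + t ∉ V}

lemma cnt_occ {n : ℕ} (V : Set (Fin n → ℤ)) (P D : Finset (Fin n → ℤ)) (R : ℝ) :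
    cnt (occ V P D) R = ∑ F ∈ (D \ P).powerset, (-1 : ℝ) ^ F.card *
      cnt {t | ∀ q ∈ P ∪ F, q + t ∈ V} R := by
  classical
  simp only [cnt, Finset.mul_sum]
  rw [Finset.sum_comm]
  refine Finset.sum_congr rfl fun t _ => ?_
  by_cases hP : ∀ q ∈ P, q + t ∈ V
  · set W := (D \ P).filter (fun y => y + t ∈ V)
    have e1 : ∀ F ∈ (D \ P).powerset, (-1 : ℝ) ^ F.card *
        Set.indicator {t | ∀ q ∈ P ∪ F, q + t ∈ V} (fun _ => (1 : ℝ)) t =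
        if F ∈ W.powerset then (-1 : ℝ) ^ F.card else 0 := by
      intro F hF
      rw [Finset.mem_powerset] at hF
      have : t ∈ {t | ∀ q ∈ P ∪ F, q + t ∈ V} ↔ F ∈ W.powerset := by
        simp only [Set.mem_ofPred_eq, Finset.mem_powerset, W, Finset.mem_union]
        constructor
        · intro h q hq
          exact Finset.mem_filter.2 ⟨hF hq, h q (Or.inr hq)⟩
        · rintro h q (hq | hq)
          · exact hP q hq
          · exact (Finset.mem_filter.1 (h hq)).2
      rw [Set.indicator_apply]
      simp only [this]
      split_ifs <;> simp
    rw [Finset.sum_congr rfl e1, ← Finset.sum_filter]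
    have e2 : (D \ P).powerset.filter (fun F => F ∈ W.powerset) = W.powerset := by
      rw [Finset.filter_mem_eq_inter]
      exact Finset.inter_eq_right.2 (Finset.powerset_mono.2 (Finset.filter_subset _ _))
    rw [e2]
    have e3 := Finset.sum_powerset_neg_one_pow_card (x := W)
    have e4 : ∑ F ∈ W.powerset, (-1 : ℝ) ^ F.card = if W = ∅ then 1 else 0 := by
      exact_mod_cast congrArg (fun z : ℤ => (z : ℝ)) e3
    rw [e4, Set.indicator_apply]
    have : t ∈ occ V P D ↔ W = ∅ := by
      rw [Finset.filter_eq_empty_iff]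
      exact ⟨fun h => h.2, fun h => ⟨hP, h⟩⟩
    simp only [this]
  · rw [Set.indicator_of_notMem (fun h => hP h.1)]
    symm
    apply Finset.sum_eq_zero
    intro F _
    rw [Set.indicator_of_notMem, mul_zero]
    intro h
    exact hP fun q hq => h q (Finset.mem_union_left _ hq)

/-- The frequency. -/
noncomputable def freq (n k : ℕ) (P D : Finset (Fin n → ℤ)) : ℝ :=
  ∑ F ∈ (D \ P).powerset, (-1 : ℝ)^F.card *
        ∏' p : Nat.Primes,
          (1 - ((redFk n ((p : ℕ)^k) (P ∪ F)).card : ℝ) / ((p : ℕ) : ℝ)^(n * k))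

lemma hasDens_occ {n k : ℕ} (hn : 1 ≤ n) (hk : 1 ≤ k) (hnk : 2 ≤ n * k)
    (P D : Finset (Fin n → ℤ)) : HasDens (occ (kfree n k) P D) (freq n k P D) := by
  have := tendsto_finsetSum (D \ P).powerset fun F _ =>
    (hasDens_Q hn hk hnk (P ∪ F)).const_mul ((-1 : ℝ) ^ F.card)
  rw [HasDens, freq, Finset.sum_mul]
  simp only [mul_assoc]
  refine this.congr fun R => ?_
  rw [cnt_occ, Finset.sum_div]
  simp only [mul_div_assoc]

lemma freq_pos {n k : ℕ} (hn : 1 ≤ n) (hk : 1 ≤ k) (hnk : 2 ≤ n * k)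
    (P D : Finset (Fin n → ℤ)) (t0 : Fin n → ℤ) (ht0 : t0 ∈ occ (kfree n k) P D) :
    0 < freq n k P D := by
  classical
  have h1 : ∀ y : {y // y ∈ D \ P}, ∃ p : Nat.Primes, ∃ z : Fin n → ℤ,
      y.1 + t0 = (((p : ℕ) : ℤ) ^ k) • z := by
    intro y
    have := ht0.2 y.1 y.2
    rw [kfree_iff] at this
    push Not at this
    exact this
  choose pr hpr using h1
  set S : Finset Nat.Primes := Finset.univ.image pr
  set G : ∀ p : Nat.Primes, Finset (Fin n → ZMod ((p : ℕ) ^ k)) :=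
    fun p => if p ∈ S then {red ((p : ℕ) ^ k) t0} else Gc k P p with hGdef
  have ht0G : ∀ p, red ((p : ℕ) ^ k) t0 ∈ Gc k P p := fun p =>
    (mem_Gc P p t0).2 fun q hq => (kfree_iff _).1 (ht0.1 q hq) p
  have ht0G' : ∀ p, red ((p : ℕ) ^ k) t0 ∈ G p := by
    intro p
    simp only [hGdef]
    split_ifs
    · simp
    · exact ht0G p
  have hsum : Summable (fun p => 1 - ((G p).card : ℝ) / ((p : ℕ) : ℝ) ^ (n * k)) := by
    refine Summable.of_norm_bounded_eventually (summable_red hnk P) ?_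
    refine (S.finite_toSet).subset ?_
    intro p hp
    by_contra hpS
    apply hp
    have hpS' : p ∉ S := hpS
    change ‖1 - ((G p).card : ℝ) / ((p : ℕ) : ℝ) ^ (n * k)‖ ≤ _
    have hGp : G p = Gc k P p := by simp only [hGdef, hpS', if_false]
    rw [hGp, card_Gc, sub_sub_cancel, Real.norm_of_nonneg (by positivity)]
  have hpos := tprod_pos_aux hsum (by
    intro p
    have h1 : 0 < (G p).card := Finset.card_pos.2 ⟨_, ht0G' p⟩
    have h2 := p.2.pos
    positivity)
  have hdens := hasDens_main hn hk hnk G P (∑ p ∈ S, (p : ℕ)) (by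
    intro p hp t ht
    have hpS : p ∉ S := by
      intro h
      have := Finset.single_le_sum (f := fun p : Nat.Primes => (p : ℕ)) (fun _ _ => Nat.zero_le _) h
      omega
    simp only [hGdef, hpS, if_false] at ht
    rw [mem_Gc] at ht
    push Not at ht
    exact ht) _ (hasProd_aux hsum)
  have hle := le_of_tendsto_of_tendsto hdens (hasDens_occ hn hk hnk P D) (by
    filter_upwards [eventually_gt_atTop 0] with R hR
    gcongr
    apply cnt_mono
    intro t ht
    have hGG : ∀ p, G p ⊆ Gc k P p := by
      intro p
      simp only [hGdef]
      split_ifs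
      · simpa using ht0G p
      · exact subset_rfl
    refine ⟨fun q hq => (kfree_iff _).2 fun p => (mem_Gc P p t).1 (hGG p (ht p)) q hq, ?_⟩
    intro y hy hmem
    set p := pr ⟨y, hy⟩
    have hpS : p ∈ S := Finset.mem_image_of_mem _ (Finset.mem_univ _)
    have h1 := ht p
    simp only [hGdef, hpS, if_true, Finset.mem_singleton] at h1
    obtain ⟨z, hz⟩ := (red_eq_iff _ _).1 h1
    have h2 := hpr ⟨y, hy⟩
    obtain ⟨w, hw⟩ := h2
    refine (kfree_iff _).1 hmem p ⟨z + w, ?_⟩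
    rw [hz, smul_add, ← hw]
    push_cast
    abel)
  have hv := vol_pos n
  have : 0 < freq n k P D * vol n := lt_of_lt_of_le (mul_pos hpos hv) hle
  exact pos_of_mul_pos_left this hv.le

end KF

/-- Any `ρ`-patch `P` of the `k`-free points of `ℤⁿ` occurs with positive frequency,
given by `ν(P) = Σ_{F ⊆ (ℤⁿ∩B_ρ(0))\P} (−1)^{|F|} ∏_p (1 − |(P∪F)_p|/p^{nk})`, where the
reduction is modulo `p^k`.  Here `D` is the finite set `ℤⁿ ∩ B_ρ(0)`. -/
theorem kfree_patch_frequency (n k : ℕ) (hn : 1 ≤ n) (hk : 1 ≤ k) (hnk : 2 ≤ n * k)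
    (ρ : ℝ) (hρ : 0 < ρ) (P D : Finset (Fin n → ℤ))
    (hD : ∀ y : Fin n → ℤ, y ∈ D ↔ ∑ i, ((y i : ℝ))^2 < ρ^2)
    (hP : ∃ t : Fin n → ℤ, ∀ y : Fin n → ℤ,
      y ∈ P ↔ (y + t ∈ kfree n k ∧ ∑ i, ((y i : ℝ))^2 < ρ^2)) :
    0 < ∑ F ∈ (D \ P).powerset, (-1 : ℝ)^F.card *
        ∏' p : Nat.Primes,
          (1 - ((redFk n ((p : ℕ)^k) (P ∪ F)).card : ℝ) / ((p : ℕ) : ℝ)^(n * k)) ∧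
    Tendsto (fun R : ℝ =>
        (Nat.card {t : Fin n → ℤ //
          (∀ y : Fin n → ℤ, (y + t ∈ kfree n k ∧ ∑ i, ((y i : ℝ))^2 < ρ^2) ↔ y ∈ P) ∧
          ∑ i, ((t i : ℝ))^2 < R^2} : ℝ) /
        (MeasureTheory.volume (Metric.ball (0 : EuclideanSpace ℝ (Fin n)) R)).toReal)
      atTop
      (𝓝 (∑ F ∈ (D \ P).powerset, (-1 : ℝ)^F.card *
        ∏' p : Nat.Primes,
          (1 - ((redFk n ((p : ℕ)^k) (P ∪ F)).card : ℝ) / ((p : ℕ) : ℝ)^(n * k)))) := by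
  have hPD : P ⊆ D := by
    obtain ⟨t0, h0⟩ := hP
    intro y hy
    exact (hD y).2 ((h0 y).1 hy).2
  have hocc : ∀ t : Fin n → ℤ, t ∈ KF.occ (kfree n k) P D ↔
      ∀ y : Fin n → ℤ, (y + t ∈ kfree n k ∧ ∑ i, ((y i : ℝ))^2 < ρ^2) ↔ y ∈ P := by
    intro t
    simp only [← hD]
    constructor
    · rintro ⟨h1, h2⟩ y
      refine ⟨fun h => ?_, fun h => ⟨h1 y h, hPD h⟩⟩
      by_contra hy
      exact h2 y (Finset.mem_sdiff.2 ⟨h.2, hy⟩) h.1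
    · intro h
      refine ⟨fun q hq => ((h q).2 hq).1, fun y hy hV => ?_⟩
      have hy' := Finset.mem_sdiff.1 hy
      exact hy'.2 ((h y).1 ⟨hV, hy'.1⟩)
  constructor
  · obtain ⟨t0, h0⟩ := hP
    exact KF.freq_pos hn hk hnk P D t0 ((hocc t0).2 fun y => (h0 y).symm)
  · have h1 := (KF.hasDens_occ hn hk hnk P D).div_const (KF.vol n)
    rw [mul_div_cancel_right₀ _ (KF.vol_pos n).ne'] at h1
    refine h1.congr' ?_
    filter_upwards [eventually_gt_atTop 0] with R hR
    rw [KF.vol_ball n hR, div_div, KF.cnt_eq_natCard]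
    simp only [hocc]
end
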